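/- (Countably closed forcing adds no new ω-sequences) Let M be a countable transitive set with (M,∈) ⊨ ZFC, let ⟨P,≼,𝟙⟩ ∈ M be a forcing notion such that every ≼-decreasing sequence s : ω → P with s ∈ M has a lower bound in P, and let G be an M-generic filter on P. Then every f ∈ M[G] that is a function from ω into a set B ∈ M satisfies f ∈ M. -/

import Mathlib

namespace CtmForcing

open FirstOrder FirstOrder.Language

/-! ### The first-order language of set theory -/

/-- The relation symbols of the language of set theory: a single binary relation `∈`. -/
inductive memRel : ℕ → Type
  | mem : memRel 2

/-- The first-order language `L` of set theory, with a single binary relation symbol `∈`. -/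
def SetLang : Language := ⟨fun _ => Empty, memRel⟩

/-- The membership relation symbol. -/
abbrev memSymb : SetLang.Relations 2 := .mem

/-- `L`-formulas (with no free "unbounded" variables) whose free variables are among
`v₀, …, v_{n-1}`. -/
abbrev BF (n : ℕ) := SetLang.BoundedFormula Empty n

/-- The atomic formula `vᵢ ∈ vⱼ`. -/
def memf {n : ℕ} (i j : Fin n) : BF n :=
  memSymb.boundedFormula₂ (Term.var (Sum.inr i)) (Term.var (Sum.inr j))

/-- The atomic formula `vᵢ = vⱼ`. -/
def eqf {n : ℕ} (i j : Fin n) : BF n :=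
  Term.bdEqual (Term.var (Sum.inr i)) (Term.var (Sum.inr j))

/-- Rename the free variables of a formula along `f`. -/
def reindex {m k : ℕ} (f : Fin m → Fin k) (φ : BF m) : BF k :=
  (BoundedFormula.relabel (Sum.map id f) φ.toFormula : SetLang.BoundedFormula Empty (k + 0))

/-- Conjunction. -/
def andF {n : ℕ} (φ ψ : BF n) : BF n := (φ.imp ψ.not).not

/-- Disjunction. -/
def orF {n : ℕ} (φ ψ : BF n) : BF n := (φ.not).imp ψ

/-- Biimplication. -/
def iffF {n : ℕ} (φ ψ : BF n) : BF n := andF (φ.imp ψ) (ψ.imp φ)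

/-! ### Basic set-theoretic formulas -/

/-- `v₀ ⊆ v₁`. -/
def subF : BF 2 := ((memf 2 0).imp (memf 2 1)).all

/-- `v₀ = ∅`. -/
def emptyF : BF 1 := ((memf 1 0).not).all

/-- `v₂ = {v₀, v₁}`. -/
def pairSetF : BF 3 := (iffF (memf 3 2) (orF (eqf 3 0) (eqf 3 1))).all

/-- `v₁ = {v₀}`. -/
def singF : BF 2 := reindex ![0, 0, 1] pairSetF

/-- `v₂ = ⟨v₀, v₁⟩` (Kuratowski ordered pair). -/
def opF : BF 3 :=
  (iffF (memf 3 2) (orF (reindex ![0, 3] singF) (reindex ![0, 1, 3] pairSetF))).all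

/-- `v₁ = v₀ ∪ {v₀}`. -/
def succF : BF 2 := (iffF (memf 2 1) (orF (memf 2 0) (eqf 2 0))).all

/-- `v₀` is transitive. -/
def transF : BF 1 := ((memf 1 0).imp (reindex ![1, 0] subF)).all

/-- `v₀` is an ordinal (a transitive set of transitive sets). -/
def ordF : BF 1 := andF transF (((memf 1 0).imp (reindex ![1] transF)).all)

/-- `⟨v₀, v₁⟩ ∈ v₂`. -/
def relMemF : BF 3 := (andF (reindex ![0, 1, 3] opF) (memf 3 2)).ex

/-- `v₂` is a function with domain `v₀` mapping onto `v₁` (a surjection from `v₀` onto `v₁`). -/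
def isFuncF : BF 3 :=
  andF
    (andF
      -- v₂ ⊆ v₀ × v₁
      (((memf 3 2).imp
        (((andF (andF (memf 4 0) (memf 5 1)) (reindex ![4, 5, 3] opF)).ex).ex)).all)
      -- total on v₀
      (((memf 3 0).imp ((andF (memf 4 1) (reindex ![3, 4, 2] relMemF)).ex)).all))
    (andF
      -- functional
      ((((andF (reindex ![3, 4, 2] relMemF) (reindex ![3, 5, 2] relMemF)).imp
          (eqf 4 5)).all).all.all)
      -- onto v₁
      (((memf 3 1).imp ((andF (memf 4 0) (reindex ![4, 3, 2] relMemF)).ex)).all))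

/-- `v₂` is injective (as a set of ordered pairs). -/
def injF : BF 3 :=
  ((((andF (reindex ![3, 5, 2] relMemF) (reindex ![4, 5, 2] relMemF)).imp
      (eqf 3 4)).all).all).all

/-- `v₂` is a bijection from `v₀` onto `v₁`. -/
def bijF : BF 3 := andF isFuncF injF

/-! ### The axioms of set theory as `L`-sentences -/

/-- Extensionality. -/
def extAx : SetLang.Sentence :=
  ((((andF subF (reindex ![1, 0] subF)).imp (eqf 0 1)).all).all : BF 0)

/-- Foundation. -/
def foundAx : SetLang.Sentence :=
  (((((memf 1 0).ex).imp
    ((andF (memf 1 0) (((memf 2 0).imp ((memf 2 1).not)).all)).ex)).all) : BF 0)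

/-- Pairing. -/
def pairAx : SetLang.Sentence := (((pairSetF.ex).all).all : BF 0)

/-- Union. -/
def unionAx : SetLang.Sentence :=
  (((((iffF (memf 2 1) ((andF (memf 3 0) (memf 2 3)).ex)).all).ex).all : BF 0))

/-- Powerset. -/
def powF : BF 2 := (iffF (memf 2 1) (reindex ![2, 0] subF)).all

/-- Powerset axiom. -/
def powAx : SetLang.Sentence := (((powF.ex).all) : BF 0)

/-- Infinity. -/
def infAx : SetLang.Sentence :=
  (((andF ((andF (memf 1 0) (reindex ![1] emptyF)).ex)
    (((memf 1 0).imp ((andF (memf 2 0) (reindex ![1, 2] succF)).ex)).all)).ex) : BF 0)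

/-- The instance of the Separation scheme given by `φ`, whose free variables are among
`v₀, …, vₙ`: the parameters are `v₀, …, v_{n-1}` and the tested element is `vₙ`.  It is the
universal closure of `∀A ∃B ∀x (x ∈ B ↔ x ∈ A ∧ φ(params, x))`. -/
def sepAx {n : ℕ} (φ : BF (n + 1)) : SetLang.Sentence :=
  -- context `n+3`: parameters `0,…,n-1`, `A = n`, `B = n+1`, `x = n+2`
  let A : Fin (n + 3) := ⟨n, by omega⟩
  let B : Fin (n + 3) := ⟨n + 1, by omega⟩
  let x : Fin (n + 3) := ⟨n + 2, by omega⟩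
  let φ' : BF (n + 3) := reindex (fun i => if h : (i : ℕ) < n then ⟨i, by omega⟩ else x) φ
  ((((iffF (memf x B) (andF (memf x A) φ')).all).ex).all).alls

/-- The instance of the Replacement scheme given by `φ`, whose free variables are among
`v₀, …, v_{n+1}`: the parameters are `v₀, …, v_{n-1}`, the argument is `x = vₙ`, and the
value is `y = v_{n+1}`.  It is the universal closure of
`∀A [(∀x∈A ∀y ∀y' (φ(x,y) ∧ φ(x,y') → y = y')) → ∃B ∀y (y ∈ B ↔ ∃x∈A φ(x,y))]`. -/
def replAx {n : ℕ} (φ : BF (n + 2)) : SetLang.Sentence :=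
  -- functionality context `n+4`: parameters, `A = n`, `x = n+1`, `y = n+2`, `y' = n+3`
  let A : Fin (n + 4) := ⟨n, by omega⟩
  let x : Fin (n + 4) := ⟨n + 1, by omega⟩
  let y : Fin (n + 4) := ⟨n + 2, by omega⟩
  let y' : Fin (n + 4) := ⟨n + 3, by omega⟩
  let φ₁ : BF (n + 4) :=
    reindex (fun i => if h : (i : ℕ) < n then ⟨i, by omega⟩ else if (i : ℕ) = n then x else y) φ
  let φ₂ : BF (n + 4) :=
    reindex (fun i => if h : (i : ℕ) < n then ⟨i, by omega⟩ else if (i : ℕ) = n then x else y') φ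
  let funcl : BF (n + 1) :=
    ((((andF (memf x A) (andF φ₁ φ₂)).imp (eqf y y')).all).all).all
  -- image context `n+4`: parameters, `A = n`, `B = n+1`, `y = n+2`, `x = n+3`
  let xi : Fin (n + 4) := ⟨n + 3, by omega⟩
  let yi : Fin (n + 4) := ⟨n + 2, by omega⟩
  let B3 : Fin (n + 3) := ⟨n + 1, by omega⟩
  let y3 : Fin (n + 3) := ⟨n + 2, by omega⟩
  let φ₃ : BF (n + 4) :=
    reindex (fun i => if h : (i : ℕ) < n then ⟨i, by omega⟩ else if (i : ℕ) = n then xi else yi) φ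
  let image : BF (n + 1) :=
    (((iffF (memf y3 B3) ((andF (memf xi A) φ₃).ex)).all).ex)
  ((funcl.imp image).all).alls

/-- The Axiom of Choice: every set is the surjective image of an ordinal. -/
def acAx : SetLang.Sentence :=
  ((((andF (reindex ![1] ordF) (reindex ![1, 0, 2] isFuncF)).ex).ex).all : BF 0)

/-- `v₀ = ω`: `v₀` is an ordinal containing `∅`, closed under successors, each of whose
elements is `∅` or a successor. -/
def omegaF : BF 1 :=
  andF (andF ordF ((andF (memf 1 0) (reindex ![1] emptyF)).ex))
    (andF (((memf 1 0).imp ((andF (memf 2 0) (reindex ![1, 2] succF)).ex)).all)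
      (((memf 1 0).imp
        (orF (reindex ![1] emptyF) ((andF (memf 2 1) (reindex ![2, 1] succF)).ex))).all))

/-- Given `v₀ = ω`, `v₁ = ℵ₁`: `v₁` is an ordinal, there is no surjection from `ω` onto `v₁`,
and every element of `v₁` is empty or a surjective image of `ω`. -/
def alephOneF : BF 2 :=
  andF (andF (reindex ![1] ordF) (((reindex ![0, 1, 2] isFuncF).ex).not))
    (((memf 2 1).imp (orF (reindex ![2] emptyF) ((reindex ![0, 2, 3] isFuncF).ex))).all)

/-- The Continuum Hypothesis `ℵ₁ = 2^ℵ₀`: there is a bijection between `𝒫(ω)` and `ℵ₁`. -/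
def chSent : SetLang.Sentence :=
  (((((andF (andF (reindex ![0] omegaF) (reindex ![0, 1] powF))
      (andF (reindex ![0, 2] alephOneF) (reindex ![1, 2, 3] bijF))).ex).ex).ex).ex : BF 0)

/-! ### The theories `Z`, `ZF`, `ZC`, `ZFC` -/

/-- The finitely many non-scheme axioms of `ZF`. -/
def zfFin : SetLang.Theory := {extAx, foundAx, pairAx, unionAx, powAx, infAx}

/-- All instances of the Separation scheme. -/
def sepScheme : SetLang.Theory := Set.range fun p : Σ n, BF (n + 1) => sepAx p.2

/-- All instances of the Replacement scheme. -/
def replScheme : SetLang.Theory := Set.range fun p : Σ n, BF (n + 2) => replAx p.2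

/-- Zermelo set theory. -/
def Z : SetLang.Theory := zfFin ∪ sepScheme

/-- Zermelo–Fraenkel set theory. -/
def ZF : SetLang.Theory := Z ∪ replScheme

/-- Zermelo set theory with Choice. -/
def ZC : SetLang.Theory := Z ∪ {acAx}

/-- Zermelo–Fraenkel set theory with Choice. -/
def ZFC : SetLang.Theory := ZF ∪ {acAx}

/-! ### Satisfaction in a set with the true membership relation -/

/-- The `L`-structure on (the elements of) a `ZFSet` `M`, with `∈` interpreted as true
membership. -/
def zfStruct (M : ZFSet) : SetLang.Structure {x : ZFSet // x ∈ M} where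
  funMap := fun f _ => f.elim
  RelMap | .mem => fun v => ((v 0 : {x : ZFSet // x ∈ M}) : ZFSet) ∈ ((v 1 : {x : ZFSet // x ∈ M}) : ZFSet)

/-- `(M, ∈) ⊨ T`: the structure on `M` with true membership satisfies every sentence of `T`. -/
def ZModels (M : ZFSet) (T : SetLang.Theory) : Prop :=
  ∀ φ ∈ T, letI := zfStruct M; Sentence.Realize (M := {x : ZFSet // x ∈ M}) φ

/-- `(M, ∈) ⊨ φ[v₀, …, v_{k-1}]`: satisfaction of the formula `φ` in `M`, with the
(membership-checked) valuation `v` of its free variables. -/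
def ZRealize (M : ZFSet) {k : ℕ} (φ : BF k) (v : Fin k → ZFSet) : Prop :=
  ∀ h : ∀ i, v i ∈ M,
    letI := zfStruct M
    BoundedFormula.Realize (M := {x : ZFSet // x ∈ M}) φ (fun e => e.elim) (fun i => ⟨v i, h i⟩)

/-- `x` is a (von Neumann) ordinal: a transitive set of transitive sets. -/
def IsOrd (x : ZFSet) : Prop := x.IsTransitive ∧ ∀ y ∈ x, ZFSet.IsTransitive y


/-! ### Forcing: names, values, generic extensions -/

/-- The value `val(G, τ)` of a name `τ` under `G`, defined by `∈`-recursion: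
`val(G, τ) = { val(G, σ) : ∃ p ∈ G, ⟨σ, p⟩ ∈ τ }`. -/
noncomputable def zval (G : ZFSet) : ZFSet → ZFSet :=
  (InvImage.wf ZFSet.rank Ordinal.lt_wf).fix fun τ ih =>
    letI : ∀ (n : ℕ) (f : (Fin n → ZFSet) → ZFSet), ZFSet.Definable n f := fun _ _ => Classical.allZFSetDefinable _
    ZFSet.image (fun σ => if h : ZFSet.rank σ < ZFSet.rank τ then ih σ h else ∅)
      (ZFSet.sep (fun σ => ∃ p ∈ G, ZFSet.pair σ p ∈ τ) (ZFSet.sUnion (ZFSet.sUnion τ)))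

/-- The generic extension `M[G] = { val(G, τ) : τ ∈ M }`. -/
noncomputable def genExt (M G : ZFSet) : ZFSet :=
  letI : ∀ (n : ℕ) (f : (Fin n → ZFSet) → ZFSet), ZFSet.Definable n f := fun _ _ => Classical.allZFSetDefinable _
  ZFSet.image (zval G) M

/-- `⟨P, r, one⟩` is a forcing notion belonging to `M`: `r ∈ M` is (the graph of) a preorder
on `P ∈ M` with greatest element `one`. -/
def ForcingNotion (M P r one : ZFSet) : Prop :=
  P ∈ M ∧ r ∈ M ∧ one ∈ P ∧
    (∀ q ∈ r, ∃ a ∈ P, ∃ b ∈ P, q = ZFSet.pair a b) ∧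
    (∀ p ∈ P, ZFSet.pair p p ∈ r) ∧
    (∀ p ∈ P, ∀ q ∈ P, ∀ s ∈ P, ZFSet.pair p q ∈ r → ZFSet.pair q s ∈ r →
      ZFSet.pair p s ∈ r) ∧
    (∀ p ∈ P, ZFSet.pair p one ∈ r)

/-- `D` is a dense subset of the forcing notion `⟨P, r⟩`. -/
def IsDenseIn (r P D : ZFSet) : Prop :=
  D ⊆ P ∧ ∀ p ∈ P, ∃ d ∈ D, ZFSet.pair d p ∈ r

/-- `G` is a filter on `⟨P, r⟩`: upward closed and downward directed. -/
def IsFilterOn (r P G : ZFSet) : Prop :=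
  G ⊆ P ∧ (∀ x ∈ G, ∀ y ∈ P, ZFSet.pair x y ∈ r → y ∈ G) ∧
    (∀ x ∈ G, ∀ y ∈ G, ∃ z ∈ G, ZFSet.pair z x ∈ r ∧ ZFSet.pair z y ∈ r)

/-- `G` is an `M`-generic filter on `⟨P, r⟩`: a filter meeting every dense subset of `P`
that belongs to `M`. -/
def IsGeneric (M r P G : ZFSet) : Prop :=
  IsFilterOn r P G ∧ ∀ D ∈ M, IsDenseIn r P D → ∃ q ∈ G, q ∈ D



set_option linter.unreachableTactic false
set_option linter.unusedTactic false
set_option linter.style.longLine false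
set_option linter.unusedSimpArgs false
set_option linter.unusedVariables false

section Definability

attribute [local instance] zfStruct

universe u

/-- elements of M -/
abbrev Mt (M : ZFSet.{u}) := {x : ZFSet.{u} // x ∈ M}

/-- Predicates definable with parameters over `M`. -/
def Dp (M : ZFSet.{u}) {n : ℕ} (R : (Fin n → Mt M) → Prop) : Prop :=
  ∃ φ : SetLang.BoundedFormula (Mt M) n, ∀ v, R v ↔ φ.Realize id v

/-- Definable functions. -/
def Df (M : ZFSet.{u}) {n : ℕ} (t : (Fin n → Mt M) → ZFSet.{u}) : Prop :=
  (∀ v, t v ∈ M) ∧ Dp M (fun w : Fin (n + 1) → Mt M => (w (Fin.last n)).1 = t (fun i => w i.castSucc))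

theorem real_mem {M : ZFSet.{u}} {α : Type*} {n : ℕ} (a b : α ⊕ Fin n) (v : α → Mt M) (xs : Fin n → Mt M) :
    (memSymb.boundedFormula₂ (Term.var a) (Term.var b) : SetLang.BoundedFormula α n).Realize v xs ↔
      (Sum.elim v xs a).1 ∈ (Sum.elim v xs b).1 := by
  rw [BoundedFormula.realize_rel₂]
  exact Iff.rfl

variable {M : ZFSet.{u}} {n : ℕ}

theorem Dp.neg {R : (Fin n → Mt M) → Prop} (h : Dp M R) : Dp M (fun v => ¬ R v) := by
  obtain ⟨φ, h⟩ := h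
  exact ⟨φ.not, fun v => by beta_reduce; rw [h, BoundedFormula.realize_not]⟩

theorem Dp.imp {R S : (Fin n → Mt M) → Prop} (h : Dp M R) (h' : Dp M S) :
    Dp M (fun v => R v → S v) := by
  obtain ⟨φ, h⟩ := h
  obtain ⟨ψ, h'⟩ := h'
  exact ⟨φ.imp ψ, fun v => by beta_reduce; rw [h, h', BoundedFormula.realize_imp]⟩

theorem Dp.congr {R S : (Fin n → Mt M) → Prop} (h : Dp M R) (h' : ∀ v, S v ↔ R v) :
    Dp M S := by
  obtain ⟨φ, h⟩ := h
  exact ⟨φ, fun v => by rw [h', h]⟩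

theorem Dp.and {R S : (Fin n → Mt M) → Prop} (h : Dp M R) (h' : Dp M S) :
    Dp M (fun v => R v ∧ S v) :=
  (h.imp h'.neg).neg.congr fun v => by tauto

theorem Dp.or {R S : (Fin n → Mt M) → Prop} (h : Dp M R) (h' : Dp M S) :
    Dp M (fun v => R v ∨ S v) :=
  (h.neg.imp h').congr fun v => by tauto

theorem Dp.iff {R S : (Fin n → Mt M) → Prop} (h : Dp M R) (h' : Dp M S) :
    Dp M (fun v => R v ↔ S v) :=
  ((h.imp h').and (h'.imp h)).congr fun v => by tauto

theorem Dp.exM {R : (Fin n → Mt M) → ZFSet.{u} → Prop}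
    (h : Dp M (fun w : Fin (n + 1) → Mt M => R (fun i => w i.castSucc) (w (Fin.last n)).1)) :
    Dp M (fun v => ∃ x ∈ M, R v x) := by
  obtain ⟨φ, h⟩ := h
  refine ⟨φ.ex, fun v => ?_⟩
  rw [BoundedFormula.realize_ex]
  have : ∀ a : Mt M, φ.Realize id (Fin.snoc v a : Fin (n + 1) → Mt M) ↔ R v a.1 := by
    intro a
    rw [← h]
    simp
  simp only [this]
  exact ⟨fun ⟨x, hx, h⟩ => ⟨⟨x, hx⟩, h⟩, fun ⟨x, h⟩ => ⟨x.1, x.2, h⟩⟩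

theorem Dp.allM {R : (Fin n → Mt M) → ZFSet.{u} → Prop}
    (h : Dp M (fun w : Fin (n + 1) → Mt M => R (fun i => w i.castSucc) (w (Fin.last n)).1)) :
    Dp M (fun v => ∀ x ∈ M, R v x) :=
  (Dp.exM (R := fun v x => ¬ R v x) h.neg).neg.congr fun v => by push Not; rfl

theorem Dp.var_mem (i j : Fin n) : Dp M (fun v : Fin n → Mt M => (v i).1 ∈ (v j).1) :=
  ⟨memSymb.boundedFormula₂ (Term.var (Sum.inr i)) (Term.var (Sum.inr j)),
    fun v => by rw [real_mem]; rfl⟩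

theorem Dp.var_eq (i j : Fin n) : Dp M (fun v : Fin n → Mt M => (v i).1 = (v j).1) :=
  ⟨Term.bdEqual (Term.var (Sum.inr i)) (Term.var (Sum.inr j)),
    fun v => by rw [BoundedFormula.realize_bdEqual]; exact Subtype.ext_iff.symm⟩

theorem Dp.var_eq_const (i : Fin n) {a : ZFSet.{u}} (ha : a ∈ M) :
    Dp M (fun v : Fin n → Mt M => (v i).1 = a) :=
  ⟨Term.bdEqual (Term.var (Sum.inr i)) (Term.var (Sum.inl ⟨a, ha⟩)),
    fun v => by
      rw [BoundedFormula.realize_bdEqual]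
      exact (Subtype.ext_iff (a1 := v i) (a2 := ⟨a, ha⟩)).symm⟩

theorem Df.var (i : Fin n) : Df M (fun v : Fin n → Mt M => (v i).1) :=
  ⟨fun v => (v i).2, Dp.var_eq _ _⟩

theorem Df.const {a : ZFSet.{u}} (ha : a ∈ M) : Df M (fun _ : Fin n → Mt M => a) :=
  ⟨fun _ => ha, Dp.var_eq_const _ ha⟩

/-- weakening: reindexing of variables -/
theorem Dp.reidx {m : ℕ} {R : (Fin n → Mt M) → Prop} (h : Dp M R) (f : Fin n → Fin m) :
    Dp M (fun w : Fin m → Mt M => R (fun i => w (f i))) := by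
  obtain ⟨φ, h⟩ := h
  refine ⟨(BoundedFormula.relabel (n := m) (Sum.map id f) φ.toFormula : SetLang.BoundedFormula (Mt M) (m + 0)), fun v => ?_⟩
  rw [BoundedFormula.realize_relabel]
  beta_reduce
  have := BoundedFormula.realize_toFormula φ (Sum.elim id v ∘ Sum.map id f)
  rw [h]
  refine Iff.trans ?_ (this.symm.trans ?_)
  · exact Iff.rfl
  · rw [Formula.Realize]
    exact iff_of_eq (congrArg₂ _ rfl (Subsingleton.elim _ _))

theorem Dp.subst {R : (Fin n → Mt M) → ZFSet.{u} → Prop} {t : (Fin n → Mt M) → ZFSet.{u}}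
    (ht : Df M t)
    (h : Dp M (fun w : Fin (n + 1) → Mt M => R (fun i => w i.castSucc) (w (Fin.last n)).1)) :
    Dp M (fun v => R v (t v)) :=
  (Dp.exM (R := fun v x => x = t v ∧ R v x) (ht.2.and h)).congr fun v =>
    ⟨fun h => ⟨_, ht.1 v, rfl, h⟩, fun ⟨_, _, h, h'⟩ => h ▸ h'⟩

theorem Df.wk {t : (Fin n → Mt M) → ZFSet.{u}} (ht : Df M t) :
    Df M (fun w : Fin (n + 1) → Mt M => t (fun i => w i.castSucc)) := by
  refine ⟨fun w => ht.1 _, ?_⟩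
  have := ht.2.reidx (m := n + 2) (Fin.snoc (fun i : Fin n => i.castSucc.castSucc) (Fin.last (n+1)))
  simpa using this

theorem Dp.mem {s t : (Fin n → Mt M) → ZFSet.{u}} (hs : Df M s) (ht : Df M t) :
    Dp M (fun v => s v ∈ t v) :=
  Dp.subst (R := fun v x => x ∈ t v) hs <|
    Dp.subst (R := fun v x => (v (Fin.last n)).1 ∈ x) ht.wk <| Dp.var_mem _ _

theorem Dp.eq {s t : (Fin n → Mt M) → ZFSet.{u}} (hs : Df M s) (ht : Df M t) :
    Dp M (fun v => s v = t v) :=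
  Dp.subst (R := fun v x => x = t v) hs <|
    Dp.subst (R := fun v x => (v (Fin.last n)).1 = x) ht.wk <| Dp.var_eq _ _

theorem Dp.bex (htr : M.IsTransitive) {R : (Fin n → Mt M) → ZFSet.{u} → Prop} {t : (Fin n → Mt M) → ZFSet.{u}}
    (ht : Df M t)
    (h : Dp M (fun w : Fin (n + 1) → Mt M => R (fun i => w i.castSucc) (w (Fin.last n)).1)) :
    Dp M (fun v => ∃ x ∈ t v, R v x) :=
  (Dp.exM (R := fun v x => x ∈ t v ∧ R v x) ((Dp.mem (Df.var _) ht.wk).and h)).congr fun v =>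
    ⟨fun ⟨x, h, h'⟩ => ⟨x, htr.subset_of_mem (ht.1 v) h, h, h'⟩, fun ⟨x, _, h⟩ => ⟨x, h⟩⟩

theorem Dp.ball (htr : M.IsTransitive) {R : (Fin n → Mt M) → ZFSet.{u} → Prop} {t : (Fin n → Mt M) → ZFSet.{u}}
    (ht : Df M t)
    (h : Dp M (fun w : Fin (n + 1) → Mt M => R (fun i => w i.castSucc) (w (Fin.last n)).1)) :
    Dp M (fun v => ∀ x ∈ t v, R v x) :=
  (Dp.bex htr (R := fun v x => ¬ R v x) ht h.neg).neg.congr fun v => by push Not; rfl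

theorem Dp.sub (htr : M.IsTransitive) {s t : (Fin n → Mt M) → ZFSet.{u}} (hs : Df M s) (ht : Df M t) :
    Dp M (fun v => s v ⊆ t v) :=
  (Dp.ball htr (R := fun v x => x ∈ t v) hs (Dp.mem (Df.var _) ht.wk)).congr fun v => ZFSet.subset_def

/-- closed under pairing -/
def PairCl (M : ZFSet.{u}) : Prop := ∀ a ∈ M, ∀ b ∈ M, ({a, b} : ZFSet.{u}) ∈ M

theorem Df.upair (htr : M.IsTransitive) (hp : PairCl M)
    {s t : (Fin n → Mt M) → ZFSet.{u}} (hs : Df M s) (ht : Df M t) :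
    Df M (fun v => ({s v, t v} : ZFSet.{u})) := by
  refine ⟨fun v => hp _ (hs.1 v) _ (ht.1 v), ?_⟩
  have := ((Dp.mem hs.wk (Df.var (Fin.last n))).and (Dp.mem ht.wk (Df.var (Fin.last n)))).and
    (Dp.ball htr (R := fun w x => x = s (fun i => w i.castSucc) ∨ x = t (fun i => w i.castSucc))
      (Df.var (Fin.last n)) ((Dp.eq (Df.var _) hs.wk.wk).or (Dp.eq (Df.var _) ht.wk.wk)))
  refine this.congr fun v => ?_
  rw [ZFSet.ext_iff]
  simp only [ZFSet.mem_pair]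
  grind

theorem PairCl.pair (hp : PairCl M) {a b : ZFSet.{u}} (ha : a ∈ M) (hb : b ∈ M) :
    ZFSet.pair a b ∈ M := by
  have := hp _ (hp _ ha _ ha) _ (hp _ ha _ hb)
  simpa [ZFSet.pair] using this

theorem Df.pair (htr : M.IsTransitive) (hp : PairCl M)
    {s t : (Fin n → Mt M) → ZFSet.{u}} (hs : Df M s) (ht : Df M t) :
    Df M (fun v => ZFSet.pair (s v) (t v)) := by
  have := Df.upair htr hp (Df.upair htr hp hs hs) (Df.upair htr hp hs ht)
  simpa [ZFSet.pair] using this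

/-! ### Unfolding the axioms -/

theorem real_memf (i j : Fin n) (v : Empty → Mt M) (xs : Fin n → Mt M) :
    (memf i j).Realize v xs ↔ (xs i).1 ∈ (xs j).1 := by
  rw [memf, real_mem]; rfl

theorem real_eqf (i j : Fin n) (v : Empty → Mt M) (xs : Fin n → Mt M) :
    (eqf i j).Realize v xs ↔ (xs i) = (xs j) := by
  rw [eqf, BoundedFormula.realize_bdEqual]; rfl

theorem real_reindex {m : ℕ} (f : Fin m → Fin n) (φ : BF m) (v : Empty → Mt M) (xs : Fin n → Mt M) :
    (reindex f φ).Realize v xs ↔ φ.Realize v (xs ∘ f) := by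
  have := BoundedFormula.realize_toFormula φ (Sum.elim v xs ∘ Sum.map id f)
  unfold reindex
  rw [BoundedFormula.realize_relabel (n := 0)]
  refine Iff.trans ?_ (this.trans ?_)
  · rw [Formula.Realize]
    exact iff_of_eq (congrArg₂ _ rfl (Subsingleton.elim _ _))
  · exact Iff.rfl

theorem real_andF (φ ψ : BF n) (v : Empty → Mt M) (xs : Fin n → Mt M) :
    (andF φ ψ).Realize v xs ↔ φ.Realize v xs ∧ ψ.Realize v xs := by
  simp [andF]

theorem real_orF (φ ψ : BF n) (v : Empty → Mt M) (xs : Fin n → Mt M) :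
    (orF φ ψ).Realize v xs ↔ φ.Realize v xs ∨ ψ.Realize v xs := by
  simp [orF]; tauto

theorem real_iffF (φ ψ : BF n) (v : Empty → Mt M) (xs : Fin n → Mt M) :
    (iffF φ ψ).Realize v xs ↔ (φ.Realize v xs ↔ ψ.Realize v xs) := by
  simp [iffF, real_andF]; tauto

/-- turn parameters into leading variables -/
theorem Dp.toBF {R : (Fin n → Mt M) → Prop} (h : Dp M R) :
    ∃ k, ∃ φ : BF (k + n), ∃ c : Fin k → Mt M, ∀ (e : Empty → Mt M) (v : Fin n → Mt M),
      R v ↔ φ.Realize e (Fin.append c v) := by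
  classical
  obtain ⟨φ, h⟩ := h
  let eqv := φ.freeVarFinset.equivFin
  let ψ : SetLang.BoundedFormula (Fin φ.freeVarFinset.card) n := φ.restrictFreeVar eqv
  let c : Fin φ.freeVarFinset.card → Mt M := fun i => (eqv.symm i).1
  refine ⟨_, ψ.relabel (n := φ.freeVarFinset.card) Sum.inr, c, fun e v => ?_⟩
  rw [BoundedFormula.realize_relabel, h]
  have := BoundedFormula.realize_restrictFreeVar (φ := φ) (f := eqv) (v := c) (xs := v) id
    (fun a => by simp [c])
  rw [← this]
  refine iff_of_eq (congrArg₂ _ ?_ ?_)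
  · funext i; simp
  · funext i; simp

theorem ZM_pair (htr : M.IsTransitive) (hM : ZModels M ZFC) : PairCl M := by
  intro a ha b hb
  have h := hM pairAx (by simp [ZFC, ZF, Z, zfFin])
  simp only [Sentence.Realize, Formula.Realize, pairAx, pairSetF, BoundedFormula.realize_all,
    BoundedFormula.realize_ex, real_iffF, real_orF, real_memf, real_eqf] at h
  obtain ⟨c, hc⟩ := h ⟨a, ha⟩ ⟨b, hb⟩
  convert c.2
  ext z
  rw [ZFSet.mem_pair]
  constructor
  · intro hz
    have hzM : z ∈ M := by rcases hz with rfl | rfl <;> assumption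
    refine (hc ⟨z, hzM⟩).2 ?_
    rcases hz with rfl | rfl
    · exact Or.inl rfl
    · exact Or.inr rfl
  · intro hz
    rcases (hc ⟨z, htr.subset_of_mem c.2 hz⟩).1 hz with h | h
    · exact Or.inl (congrArg Subtype.val h)
    · exact Or.inr (congrArg Subtype.val h)

theorem ZM_sUnion (htr : M.IsTransitive) (hM : ZModels M ZFC) {a : ZFSet.{u}} (ha : a ∈ M) :
    (ZFSet.sUnion a) ∈ M := by
  have h := hM unionAx (by simp [ZFC, ZF, Z, zfFin])
  simp only [Sentence.Realize, Formula.Realize, unionAx, BoundedFormula.realize_all,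
    BoundedFormula.realize_ex, real_iffF, real_andF, real_memf, real_eqf] at h
  obtain ⟨c, hc⟩ := h ⟨a, ha⟩
  convert c.2
  ext z
  rw [ZFSet.mem_sUnion]
  constructor
  · rintro ⟨y, hy, hz⟩
    have hyM := htr.subset_of_mem ha hy
    exact (hc ⟨z, htr.subset_of_mem hyM hz⟩).2 ⟨⟨y, hyM⟩, hy, hz⟩
  · intro hz
    obtain ⟨y, hy, hz⟩ := (hc ⟨z, htr.subset_of_mem c.2 hz⟩).1 hz
    exact ⟨y.1, hy, hz⟩

theorem ZM_union (htr : M.IsTransitive) (hM : ZModels M ZFC) {a b : ZFSet.{u}} (ha : a ∈ M) (hb : b ∈ M) :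
    a ∪ b ∈ M := ZM_sUnion htr hM (ZM_pair htr hM a ha b hb)

theorem ZM_pow (htr : M.IsTransitive) (hM : ZModels M ZFC) {a : ZFSet.{u}} (ha : a ∈ M) :
    ∃ c ∈ M, ∀ z ∈ M, z ∈ c ↔ z ⊆ a := by
  have h := hM powAx (by simp [ZFC, ZF, Z, zfFin])
  simp only [Sentence.Realize, Formula.Realize, powAx, powF, subF, BoundedFormula.realize_all,
    BoundedFormula.realize_ex, real_iffF, real_andF, real_memf, real_eqf, real_reindex,
    BoundedFormula.realize_imp] at h
  obtain ⟨c, hc⟩ := h ⟨a, ha⟩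
  refine ⟨c.1, c.2, fun z hz => (hc ⟨z, hz⟩).trans ?_⟩
  rw [ZFSet.subset_def]
  exact ⟨fun h x hx => h ⟨x, htr.subset_of_mem hz hx⟩ hx, fun h x hx => h hx⟩

theorem ZM_inf (htr : M.IsTransitive) (hM : ZModels M ZFC) :
    ∃ c ∈ M, ∅ ∈ c ∧ ∀ z ∈ c, insert z z ∈ c := by
  have h := hM infAx (by simp [ZFC, ZF, Z, zfFin])
  simp only [Sentence.Realize, Formula.Realize, infAx, emptyF, succF, BoundedFormula.realize_all,
    BoundedFormula.realize_ex, real_iffF, real_andF, real_orF, real_memf, real_eqf, real_reindex,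
    BoundedFormula.realize_imp, BoundedFormula.realize_not] at h
  obtain ⟨c, ⟨e, hec, he⟩, hc⟩ := h
  refine ⟨c.1, c.2, ?_, fun z hz => ?_⟩
  · have : e.1 = ∅ := (ZFSet.eq_empty _).2 fun y hy => he ⟨y, htr.subset_of_mem e.2 hy⟩ hy
    exact this ▸ hec
  · have hzM := htr.subset_of_mem c.2 hz
    obtain ⟨s, hsc, hs⟩ := hc ⟨z, hzM⟩ hz
    have : s.1 = insert z z := by
      ext y
      rw [ZFSet.mem_insert_iff]
      constructor
      · intro hy
        rcases (hs ⟨y, htr.subset_of_mem s.2 hy⟩).1 hy with h | h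
        · exact Or.inr h
        · exact Or.inl (congrArg Subtype.val h)
      · intro hy
        have hyM : y ∈ M := by
          rcases hy with rfl | hy
          · exact hzM
          · exact htr.subset_of_mem hzM hy
        refine (hs ⟨y, hyM⟩).2 ?_
        rcases hy with rfl | hy
        · exact Or.inr rfl
        · exact Or.inl hy
    exact this ▸ hsc

theorem ZM_sep (htr : M.IsTransitive) (hM : ZModels M ZFC) {a : ZFSet.{u}} (ha : a ∈ M)
    {R : ZFSet.{u} → Prop} (hR : Dp M (fun v : Fin 1 → Mt M => R (v 0).1)) :
    ZFSet.sep R a ∈ M := by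
  obtain ⟨k, φ, c, hφ⟩ := hR.toBF
  have h := hM (sepAx φ) (Or.inl (Or.inl (Or.inr ⟨⟨k, φ⟩, rfl⟩)))
  simp only [Sentence.Realize, sepAx, BoundedFormula.realize_alls, BoundedFormula.realize_all,
    BoundedFormula.realize_ex, real_iffF, real_andF, real_memf, real_eqf, real_reindex,
    BoundedFormula.realize_imp] at h
  obtain ⟨b, hb⟩ := h c ⟨a, ha⟩
  convert b.2
  ext z
  rw [ZFSet.mem_sep]
  have key : ∀ x : Mt M, x.1 ∈ b.1 ↔ (x.1 ∈ a ∧ R x.1) := by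
    intro x
    have := hb x
    have e1 : (Fin.snoc (Fin.snoc (Fin.snoc c ⟨a, ha⟩ : Fin (k+1) → Mt M) b : Fin (k+2) → Mt M) x : Fin (k+3) → Mt M) ⟨k+2, by omega⟩ = x := by
      simp [Fin.snoc]
    have e2 : (Fin.snoc (Fin.snoc (Fin.snoc c ⟨a, ha⟩ : Fin (k+1) → Mt M) b : Fin (k+2) → Mt M) x : Fin (k+3) → Mt M) ⟨k+1, by omega⟩ = b := by
      simp [Fin.snoc]
    have e3 : (Fin.snoc (Fin.snoc (Fin.snoc c ⟨a, ha⟩ : Fin (k+1) → Mt M) b : Fin (k+2) → Mt M) x : Fin (k+3) → Mt M) ⟨k, by omega⟩ = ⟨a, ha⟩ := by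
      simp [Fin.snoc]
    rw [e1, e2, e3] at this
    rw [this]
    refine and_congr_right fun _ => ?_
    refine Iff.trans ?_ (hφ default (fun _ => x)).symm
    refine iff_of_eq (congrArg₂ _ rfl ?_)
    funext i
    refine Fin.addCases (fun j => ?_) (fun j => ?_) i
    · have := j.2
      simp [Fin.snoc, show (j:ℕ) < k+1 by omega, show (j:ℕ) < k+2 by omega]
    · simp [Fin.snoc]
  constructor
  · rintro ⟨h1, h2⟩
    exact (key ⟨z, htr.subset_of_mem ha h1⟩).2 ⟨h1, h2⟩
  · intro hz
    exact (key ⟨z, htr.subset_of_mem b.2 hz⟩).1 hz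

theorem ZM_repl (htr : M.IsTransitive) (hM : ZModels M ZFC) {a : ZFSet.{u}} (ha : a ∈ M)
    {R : ZFSet.{u} → ZFSet.{u} → Prop} (hR : Dp M (fun v : Fin 2 → Mt M => R (v 0).1 (v 1).1))
    (hfun : ∀ x ∈ a, ∀ y ∈ M, ∀ y' ∈ M, R x y → R x y' → y = y') :
    ∃ b ∈ M, ∀ y ∈ M, y ∈ b ↔ ∃ x ∈ a, R x y := by
  obtain ⟨k, φ, c, hφ⟩ := hR.toBF
  have h := hM (replAx φ) (Or.inl (Or.inr ⟨⟨k, φ⟩, rfl⟩))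
  simp only [Sentence.Realize, replAx, BoundedFormula.realize_alls, BoundedFormula.realize_all,
    BoundedFormula.realize_ex, real_iffF, real_andF, real_memf, real_eqf, real_reindex,
    BoundedFormula.realize_imp] at h
  have fin : ∀ (w : Fin (k + 2) → Mt M) (x y : Mt M), (∀ j : Fin k, w (Fin.castAdd 2 j) = c j) →
      w (Fin.natAdd k 0) = x → w (Fin.natAdd k 1) = y → (φ.Realize default w ↔ R x.1 y.1) := by
    intro w x y h1 h2 h3
    refine Iff.trans ?_ (hφ default ![x, y]).symm
    refine iff_of_eq (congrArg₂ _ rfl ?_)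
    funext i
    refine Fin.addCases (fun j => ?_) (fun j => ?_) i
    · rw [h1]; simp
    · fin_cases j
      · simpa using h2
      · simpa using h3
  obtain ⟨b, hb⟩ := h c ⟨a, ha⟩ (by
    rintro x y y' ⟨h1, h2, h3⟩
    rw [fin _ x y] at h2
    rw [fin _ x y'] at h3
    · have e1 : (Fin.snoc (Fin.snoc (Fin.snoc (Fin.snoc c ⟨a, ha⟩ : Fin (k+1) → Mt M) x : Fin (k+2) → Mt M) y : Fin (k+3) → Mt M) y' : Fin (k+4) → Mt M) ⟨k+2, by omega⟩ = y := by
        simp [Fin.snoc]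
      have e2 : (Fin.snoc (Fin.snoc (Fin.snoc (Fin.snoc c ⟨a, ha⟩ : Fin (k+1) → Mt M) x : Fin (k+2) → Mt M) y : Fin (k+3) → Mt M) y' : Fin (k+4) → Mt M) ⟨k+3, by omega⟩ = y' := by
        simp [Fin.snoc]
      rw [e1, e2]
      simp [Fin.snoc] at h1
      exact Subtype.ext (hfun _ h1 _ y.2 _ y'.2 h2 h3)
    · intro j
      have := j.2
      simp [Fin.snoc, show (j:ℕ) < k+1 by omega, show (j:ℕ) < k+2 by omega, show (j:ℕ) < k+3 by omega]
    · simp [Fin.snoc]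
    · simp [Fin.snoc]
    · intro j
      have := j.2
      simp [Fin.snoc, show (j:ℕ) < k+1 by omega, show (j:ℕ) < k+2 by omega, show (j:ℕ) < k+3 by omega]
    · simp [Fin.snoc]
    · simp [Fin.snoc])
  refine ⟨b.1, b.2, fun y hy => ?_⟩
  have := hb ⟨y, hy⟩
  have e1 : (Fin.snoc (Fin.snoc (Fin.snoc c ⟨a, ha⟩ : Fin (k+1) → Mt M) b : Fin (k+2) → Mt M) ⟨y, hy⟩ : Fin (k+3) → Mt M) ⟨k+2, by omega⟩ = ⟨y, hy⟩ := by
    simp [Fin.snoc]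
  have e2 : (Fin.snoc (Fin.snoc (Fin.snoc c ⟨a, ha⟩ : Fin (k+1) → Mt M) b : Fin (k+2) → Mt M) ⟨y, hy⟩ : Fin (k+3) → Mt M) ⟨k+1, by omega⟩ = b := by
    simp [Fin.snoc]
  rw [e1, e2] at this
  rw [this]
  constructor
  · rintro ⟨x, h1, h2⟩
    rw [fin _ x ⟨y, hy⟩] at h2
    · simp [Fin.snoc] at h1
      exact ⟨x.1, h1, h2⟩
    · intro j
      have := j.2
      simp [Fin.snoc, show (j:ℕ) < k+1 by omega, show (j:ℕ) < k+2 by omega, show (j:ℕ) < k+3 by omega]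
    · simp [Fin.snoc]
    · simp [Fin.snoc]
  · rintro ⟨x, h1, h2⟩
    have hxM := htr.subset_of_mem ha h1
    refine ⟨⟨x, hxM⟩, ?_, (fin _ ⟨x, hxM⟩ ⟨y, hy⟩ ?_ ?_ ?_).2 h2⟩
    · simpa [Fin.snoc] using h1
    · intro j
      have := j.2
      simp [Fin.snoc, show (j:ℕ) < k+1 by omega, show (j:ℕ) < k+2 by omega, show (j:ℕ) < k+3 by omega]
    · simp [Fin.snoc]
    · simp [Fin.snoc]

theorem real_opF (htr : M.IsTransitive) (hp : PairCl M) (v : Empty → Mt M) (xs : Fin 3 → Mt M) :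
    opF.Realize v xs ↔ (xs 2).1 = ZFSet.pair (xs 0).1 (xs 1).1 := by
  have key : ∀ a b c : Mt M, (∀ z : Mt M, z.1 ∈ c.1 ↔ (z = a ∨ z = b)) ↔ c.1 = {a.1, b.1} := by
    intro a b c
    constructor
    · intro h
      ext z
      rw [ZFSet.mem_pair]
      constructor
      · intro hz
        rcases (h ⟨z, htr.subset_of_mem c.2 hz⟩).1 hz with h | h
        · exact Or.inl (congrArg Subtype.val h)
        · exact Or.inr (congrArg Subtype.val h)
      · rintro (rfl | rfl)
        · exact (h a).2 (Or.inl rfl)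
        · exact (h b).2 (Or.inr rfl)
    · intro h z
      rw [h, ZFSet.mem_pair, Subtype.ext_iff, Subtype.ext_iff]
  simp only [opF, singF, pairSetF, BoundedFormula.realize_all, real_iffF, real_orF, real_reindex,
    real_memf, real_eqf]
  have := key ⟨{(xs 0).1}, by simpa using hp _ (xs 0).2 _ (xs 0).2⟩ ⟨_, hp _ (xs 0).2 _ (xs 1).2⟩ (xs 2)
  rw [ZFSet.pair]
  refine Iff.trans (forall_congr' fun z => ?_) this
  refine iff_congr Iff.rfl (or_congr ?_ ?_)
  · refine (key (xs 0) (xs 0) z).trans ?_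
    rw [Subtype.ext_iff]
    exact iff_of_eq (congrArg (fun t => z.1 = t) (ZFSet.pair_eq_singleton _))
  · refine (key (xs 0) (xs 1) z).trans ?_
    rw [Subtype.ext_iff]

theorem ZM_ac (htr : M.IsTransitive) (hM : ZModels M ZFC) {a : ZFSet.{u}} (ha : a ∈ M) :
    ∃ α ∈ M, ∃ h ∈ M, α.IsOrdinal ∧
      (∀ y ∈ a, ∃ ξ ∈ α, ZFSet.pair ξ y ∈ h) ∧
      (∀ ξ y y', ZFSet.pair ξ y ∈ h → ZFSet.pair ξ y' ∈ h → y = y') := by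
  have hp := ZM_pair htr hM
  have h := hM acAx (Or.inr rfl)
  simp only [Sentence.Realize, Formula.Realize, acAx, ordF, transF, subF, isFuncF, relMemF,
    BoundedFormula.realize_all,
    BoundedFormula.realize_ex, real_iffF, real_andF, real_orF, real_memf, real_eqf, real_reindex,
    BoundedFormula.realize_imp, BoundedFormula.realize_not, real_opF htr hp] at h
  obtain ⟨α, h, ⟨o1, o2⟩, ⟨_, _⟩, f3, f4⟩ := h ⟨a, ha⟩
  have inM : ∀ {x y : ZFSet.{u}}, ZFSet.pair x y ∈ h.1 → x ∈ M ∧ y ∈ M := by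
    intro x y hxy
    have h1 := htr.subset_of_mem h.2 hxy
    have h2 : ({x, y} : ZFSet) ∈ M := htr.subset_of_mem h1 (by simp [ZFSet.pair])
    exact ⟨htr.subset_of_mem h2 (by simp), htr.subset_of_mem h2 (by simp)⟩
  refine ⟨α.1, α.2, h.1, h.2, ?_, ?_, ?_⟩
  · rw [ZFSet.isOrdinal_iff_forall_mem_isTransitive]
    constructor
    · intro x hx
      have hxM := htr.subset_of_mem α.2 hx
      rw [ZFSet.subset_def]
      exact fun y hy => o1 ⟨x, hxM⟩ hx ⟨y, htr.subset_of_mem hxM hy⟩ hy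
    · intro z hz x hx
      have hzM := htr.subset_of_mem α.2 hz
      have hxM := htr.subset_of_mem hzM hx
      rw [ZFSet.subset_def]
      exact fun y hy => o2 ⟨z, hzM⟩ hz ⟨x, hxM⟩ hx ⟨y, htr.subset_of_mem hxM hy⟩ hy
  · intro y hy
    obtain ⟨ξ, hξ, w, hw, hw'⟩ := f4 ⟨y, htr.subset_of_mem ha hy⟩ hy
    refine ⟨ξ.1, hξ, ?_⟩
    have : w.1 = ZFSet.pair ξ.1 y := hw
    exact this ▸ hw'
  · intro ξ y y' h1 h2
    have := f3 ⟨ξ, (inM h1).1⟩ ⟨y, (inM h1).2⟩ ⟨y', (inM h2).2⟩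
      ⟨⟨⟨_, hp.pair (inM h1).1 (inM h1).2⟩, rfl, h1⟩, ⟨⟨_, hp.pair (inM h2).1 (inM h2).2⟩, rfl, h2⟩⟩
    exact congrArg Subtype.val this

theorem ZM_prod (htr : M.IsTransitive) (hM : ZModels M ZFC) {a b : ZFSet.{u}} (ha : a ∈ M) (hb : b ∈ M) :
    ZFSet.prod a b ∈ M := by
  have hp := ZM_pair htr hM
  obtain ⟨c, hc, hc'⟩ := ZM_pow htr hM (ZM_union htr hM ha hb)
  obtain ⟨d, hd, hd'⟩ := ZM_pow htr hM hc
  have := ZM_sep htr hM hd (R := fun z => ∃ x ∈ a, ∃ y ∈ b, z = ZFSet.pair x y) (by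
    repeat' first | exact Df.var _ | exact Df.const (by assumption) | apply Dp.neg | apply Dp.and | apply Dp.or | apply Dp.sub htr | apply Dp.mem | apply Dp.eq | apply Dp.exM | apply Dp.allM | apply Dp.bex htr | apply Dp.ball htr | apply Dp.imp | apply Dp.iff | apply Df.pair htr hp)
  convert this using 1
  ext z
  rw [ZFSet.mem_sep, ZFSet.mem_prod]
  refine ⟨fun h => ⟨?_, h⟩, fun h => h.2⟩
  obtain ⟨x, hx, y, hy, rfl⟩ := h
  have hxM := htr.subset_of_mem ha hx
  have hyM := htr.subset_of_mem hb hy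
  rw [hd' _ (hp.pair hxM hyM), ZFSet.subset_def]
  intro w hw
  have h1 := hp _ hxM _ hxM
  have h2 := hp _ hxM _ hyM
  rw [ZFSet.pair_eq_singleton] at h1
  rw [ZFSet.pair, ZFSet.mem_pair] at hw
  rcases hw with rfl | rfl
  · rw [hc' _ h1, ZFSet.subset_def]
    intro w hw
    rw [ZFSet.mem_singleton] at hw
    subst hw
    exact ZFSet.mem_union.2 (Or.inl hx)
  · rw [hc' _ h2, ZFSet.subset_def]
    intro w hw
    rw [ZFSet.mem_pair] at hw
    rcases hw with rfl | rfl
    · exact ZFSet.mem_union.2 (Or.inl hx)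
    · exact ZFSet.mem_union.2 (Or.inr hy)

theorem omega_sub {J : ZFSet.{u}} (h0 : ∅ ∈ J) (hs : ∀ z ∈ J, insert z z ∈ J) :
    ∀ x ∈ ZFSet.omega.{u}, x ∈ J := by
  have : ∀ n : ℕ, ZFSet.mk (PSet.ofNat n) ∈ J := by
    intro n
    induction n with
    | zero => exact h0
    | succ n ih => exact hs _ ih
  intro x
  refine Quotient.inductionOn x fun x => ?_
  rintro ⟨⟨n⟩, h⟩
  have e : (ZFSet.mk x : ZFSet.{u}) = ZFSet.mk (PSet.ofNat n) := ZFSet.sound h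
  have := this n
  rw [← e] at this
  exact this

theorem ZM_omega (htr : M.IsTransitive) (hM : ZModels M ZFC) : ZFSet.omega.{u} ∈ M := by
  have hp := ZM_pair htr hM
  obtain ⟨I, hI, h0, hs⟩ := ZM_inf htr hM
  have h0M : ∅ ∈ M := htr.subset_of_mem hI h0
  let Ind : ZFSet.{u} → Prop := fun J => ∅ ∈ J ∧ ∀ y ∈ J, ∃ z ∈ J, y ∈ z ∧ y ⊆ z ∧ ∀ w ∈ z, w ∈ y ∨ w = y
  have hInd : ∀ J, Ind J ↔ (∅ ∈ J ∧ ∀ y ∈ J, insert y y ∈ J) := by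
    intro J
    refine and_congr_right fun _ => forall₂_congr fun y hy => ⟨?_, ?_⟩
    · rintro ⟨z, hz, h1, h2, h3⟩
      convert hz
      ext w
      rw [ZFSet.mem_insert_iff]
      constructor
      · rintro (rfl | h)
        · exact h1
        · exact h2 h
      · intro h
        exact (h3 w h).symm
    · intro h
      refine ⟨_, h, by simp, ?_, ?_⟩
      · rw [ZFSet.subset_def]
        intro w hw
        exact ZFSet.mem_insert_of_mem _ hw
      · intro w hw
        exact (ZFSet.mem_insert_iff.1 hw).symm
  have hW := ZM_sep htr hM hI (R := fun x => ∀ J ∈ M, Ind J → x ∈ J) (by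
    simp only [Ind]
    repeat' first | exact Df.var _ | exact Df.const (by assumption) | apply Dp.neg | apply Dp.and | apply Dp.or | apply Dp.sub htr | apply Dp.mem | apply Dp.eq | apply Dp.exM | apply Dp.allM | apply Dp.bex htr | apply Dp.ball htr | apply Dp.imp | apply Dp.iff | apply Df.pair htr hp)
  generalize hWe : ZFSet.sep (fun x => ∀ J ∈ M, Ind J → x ∈ J) I = W at hW
  have mW : ∀ x, x ∈ W ↔ x ∈ I ∧ ∀ J ∈ M, Ind J → x ∈ J := by
    intro x; rw [← hWe, ZFSet.mem_sep]
  have W0 : ∅ ∈ W := (mW _).2 ⟨h0, fun J _ hJ => hJ.1⟩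
  have Ws : ∀ y ∈ W, insert y y ∈ W := fun y hy => (mW _).2 ⟨hs _ ((mW _).1 hy).1,
    fun J hJM hJ => ((hInd J).1 hJ).2 _ (((mW _).1 hy).2 J hJM hJ)⟩
  suffices ZFSet.omega.{u} = W from this ▸ hW
  ext x
  refine ⟨omega_sub W0 Ws x, ?_⟩
  refine ZFSet.inductionOn x fun x ih hx => ?_
  by_contra hxo
  have hxM := htr.subset_of_mem hW hx
  have hD := ZM_sep htr hM hW (R := fun y => ¬ y = x) (by
    repeat' first | exact Df.var _ | exact Df.const (by assumption) | apply Dp.neg | apply Dp.and | apply Dp.or | apply Dp.sub htr | apply Dp.mem | apply Dp.eq | apply Dp.exM | apply Dp.allM | apply Dp.bex htr | apply Dp.ball htr | apply Dp.imp | apply Dp.iff | apply Df.pair htr hp)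
  have := ((mW x).1 hx).2 _ hD ((hInd _).2 ⟨?_, ?_⟩)
  · exact (ZFSet.mem_sep.1 this).2 rfl
  · refine ZFSet.mem_sep.2 ⟨W0, ?_⟩
    rintro rfl
    exact hxo ZFSet.omega_zero
  · intro y hy
    rw [ZFSet.mem_sep] at hy ⊢
    refine ⟨Ws _ hy.1, ?_⟩
    rintro rfl
    exact hxo (ZFSet.omega_succ (ih y (by simp) hy.1))

theorem ZM_trcl (htr : M.IsTransitive) (hM : ZModels M ZFC) (x : ZFSet.{u}) : x ∈ M →
    ∃ T ∈ M, (T.IsTransitive ∧ x ⊆ T ∧ ∀ T' ∈ M, T'.IsTransitive → x ⊆ T' → T ⊆ T') := by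
  have hp := ZM_pair htr hM
  refine ZFSet.inductionOn x fun x ih hx => ?_
  obtain ⟨b, hbM, hb⟩ := ZM_repl htr hM hx
    (R := fun x T => (T.IsTransitive ∧ x ⊆ T ∧ ∀ T' ∈ M, T'.IsTransitive → x ⊆ T' → T ⊆ T')) (by
      simp only [ZFSet.IsTransitive]
      repeat' first | exact Df.var _ | exact Df.const (by assumption) | apply Dp.neg | apply Dp.and | apply Dp.or | apply Dp.sub htr | apply Dp.mem | apply Dp.eq | apply Dp.exM | apply Dp.allM | apply Dp.bex htr | apply Dp.ball htr | apply Dp.imp | apply Dp.iff | apply Df.pair htr hp)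
    (fun z hz y hy y' hy' h h' => by
      have h1 := h.2.2 y' hy' h'.1 h'.2.1
      have h2 := h'.2.2 y hy h.1 h.2.1
      ext w
      exact ⟨fun h => h1 h, fun h => h2 h⟩)
  have hU := ZM_sUnion htr hM hbM
  have memU : ∀ w, w ∈ ZFSet.sUnion b ↔ ∃ T ∈ b, w ∈ T := fun w => ZFSet.mem_sUnion
  refine ⟨x ∪ ZFSet.sUnion b, ZM_union htr hM hx hU, ?_, ?_, ?_⟩
  · intro y hy
    rw [ZFSet.subset_def]
    intro w hw
    rw [ZFSet.mem_union, memU] at hy ⊢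
    right
    rcases hy with hy | ⟨T, hT, hy⟩
    · obtain ⟨T, hTM, hT⟩ := ih y hy (htr.subset_of_mem hx hy)
      exact ⟨T, (hb T hTM).2 ⟨y, hy, hT⟩, hT.2.1 hw⟩
    · obtain ⟨u, hu, h1, h2⟩ := (hb T (htr.subset_of_mem hbM hT)).1 hT
      exact ⟨T, hT, h1.subset_of_mem hy hw⟩
  · rw [ZFSet.subset_def]
    intro w hw
    exact ZFSet.mem_union.2 (Or.inl hw)
  · intro T' hT'M hT' hxT'
    rw [ZFSet.subset_def]
    intro w hw
    rw [ZFSet.mem_union, memU] at hw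
    rcases hw with hw | ⟨T, hT, hw⟩
    · exact hxT' hw
    · obtain ⟨u, hu, h1, h2, h3⟩ := (hb T (htr.subset_of_mem hbM hT)).1 hT
      exact h3 T' hT'M hT' (hT'.subset_of_mem (hxT' hu)) hw

theorem rank_lt_of_pair {σ p τ : ZFSet.{u}} (h : ZFSet.pair σ p ∈ τ) : σ.rank < τ.rank := by
  have h1 : ({σ} : ZFSet.{u}) ∈ ZFSet.pair σ p := by simp [ZFSet.pair]
  have h2 : σ ∈ ({σ} : ZFSet.{u}) := by simp
  exact ((ZFSet.rank_lt_of_mem h2).trans (ZFSet.rank_lt_of_mem h1)).trans (ZFSet.rank_lt_of_mem h)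

theorem mem_zval {G τ y : ZFSet.{u}} :
    y ∈ zval G τ ↔ ∃ σ, ∃ p ∈ G, ZFSet.pair σ p ∈ τ ∧ y = zval G σ := by
  rw [zval, WellFounded.fix_eq]
  simp only [ZFSet.mem_image, ZFSet.mem_sep, ZFSet.mem_sUnion]
  constructor
  · rintro ⟨σ, ⟨_, p, hp, hσ⟩, rfl⟩
    refine ⟨σ, p, hp, hσ, ?_⟩
    rw [dif_pos (rank_lt_of_pair hσ)]
  · rintro ⟨σ, p, hp, hσ, rfl⟩
    refine ⟨σ, ⟨⟨{σ}, ⟨_, hσ, by simp [ZFSet.pair]⟩, by simp⟩, p, hp, hσ⟩, ?_⟩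
    rw [dif_pos (rank_lt_of_pair hσ)]

theorem mem_genExt {M G f : ZFSet.{u}} : f ∈ genExt M G ↔ ∃ τ ∈ M, zval G τ = f := by
  rw [genExt]
  simp only [ZFSet.mem_image]

theorem dense_below (htr : M.IsTransitive) (hM : ZModels M ZFC) {P r one G : ZFSet.{u}}
    (hF : ForcingNotion M P r one) (hG : IsGeneric M r P G) {D q0 : ZFSet.{u}} (hD : D ∈ M)
    (hDP : D ⊆ P)
    (hq0 : q0 ∈ G) (h : ∀ q ∈ P, ZFSet.pair q q0 ∈ r → ∃ q' ∈ D, ZFSet.pair q' q ∈ r) :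
    ∃ q ∈ G, q ∈ D := by
  have hp := ZM_pair htr hM
  obtain ⟨hP, hr, h1, hrP, hrefl, htrans, hone⟩ := hF
  obtain ⟨⟨hGP, hGu, hGd⟩, hgen⟩ := hG
  have hq0M : q0 ∈ M := htr.subset_of_mem hP (hGP hq0)
  have hE := ZM_sep htr hM hP (R := fun q => q ∈ D ∨ ¬ ∃ q' ∈ P, ZFSet.pair q' q ∈ r ∧ ZFSet.pair q' q0 ∈ r) (by
    repeat' first | exact Df.var _ | exact Df.const (by assumption) | apply Dp.neg | apply Dp.and | apply Dp.or | apply Dp.sub htr | apply Dp.mem | apply Dp.eq | apply Dp.exM | apply Dp.allM | apply Dp.bex htr | apply Dp.ball htr | apply Dp.imp | apply Dp.iff | apply Df.pair htr hp)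
  obtain ⟨q, hqG, hq⟩ := hgen _ hE ⟨fun z hz => (ZFSet.mem_sep.1 hz).1, by
    intro p hpP
    by_cases hc : ∃ q' ∈ P, ZFSet.pair q' p ∈ r ∧ ZFSet.pair q' q0 ∈ r
    · obtain ⟨q', hq', h2, h3⟩ := hc
      obtain ⟨d, hd, h4⟩ := h q' hq' h3
      exact ⟨d, ZFSet.mem_sep.2 ⟨hDP hd, Or.inl hd⟩, htrans d (hDP hd) q' hq' p hpP h4 h2⟩
    · exact ⟨p, ZFSet.mem_sep.2 ⟨hpP, Or.inr hc⟩, hrefl p hpP⟩⟩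
  rw [ZFSet.mem_sep] at hq
  rcases hq.2 with h2 | h2
  · exact ⟨q, hqG, h2⟩
  · obtain ⟨z, hz, h3, h4⟩ := hGd q hqG q0 hq0
    exact absurd ⟨z, hGP hz, h3, h4⟩ h2

/-- The recursive clause for forcing `σ = x`. -/
def Cl (P r T F σ x p : ZFSet.{u}) : Prop :=
  (∀ π ∈ T, ∀ s ∈ P, ZFSet.pair π s ∈ σ → ∀ q ∈ P, ZFSet.pair q p ∈ r → ZFSet.pair q s ∈ r →
    ∃ q' ∈ P, ZFSet.pair q' q ∈ r ∧ ∃ y ∈ x, ZFSet.pair π (ZFSet.pair y q') ∈ F) ∧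
  (∀ y ∈ x, ∀ q ∈ P, ZFSet.pair q p ∈ r → ∃ q' ∈ P, ZFSet.pair q' q ∈ r ∧
    ∃ π ∈ T, ∃ s ∈ P, ZFSet.pair π s ∈ σ ∧ ZFSet.pair q' s ∈ r ∧ ZFSet.pair π (ZFSet.pair y q') ∈ F)

theorem Cl.mono {P r T F F' σ x p : ZFSet.{u}} (h : Cl P r T F σ x p) (hF : ∀ z ∈ F, z ∈ F') :
    Cl P r T F' σ x p := by
  constructor
  · intro π hπ s hs hσ q hq h1 h2
    obtain ⟨q', hq', h3, y, hy, h4⟩ := h.1 π hπ s hs hσ q hq h1 h2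
    exact ⟨q', hq', h3, y, hy, hF _ h4⟩
  · intro y hy q hq h1
    obtain ⟨q', hq', h3, π, hπ, s, hs, h4, h5, h6⟩ := h.2 y hy q hq h1
    exact ⟨q', hq', h3, π, hπ, s, hs, h4, h5, hF _ h6⟩

theorem exists_E (htr : M.IsTransitive) (hM : ZModels M ZFC) {P r T : ZFSet.{u}}
    (hP : P ∈ M) (hr : r ∈ M) (hT : T ∈ M) :
    ∃ E ∈ M, ∀ σ ∈ T, ∀ x ∈ T, ∀ p ∈ P, ZFSet.pair σ (ZFSet.pair x p) ∈ E ↔ Cl P r T E σ x p := by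
  have hp := ZM_pair htr hM
  have hK := ZM_prod htr hM hT (ZM_prod htr hM hT hP)
  have mK : ∀ σ ∈ T, ∀ x ∈ T, ∀ p ∈ P, ZFSet.pair σ (ZFSet.pair x p) ∈ ZFSet.prod T (ZFSet.prod T P) := by
    intro σ hσ x hx p hp
    rw [ZFSet.pair_mem_prod, ZFSet.pair_mem_prod]
    exact ⟨hσ, hx, hp⟩
  have hE := ZM_sep htr hM hK (R := fun z => ∀ F ∈ M, (∀ σ ∈ T, ∀ x ∈ T, ∀ p ∈ P, Cl P r T F σ x p →
      ZFSet.pair σ (ZFSet.pair x p) ∈ F) → z ∈ F) (by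
    simp only [Cl]
    repeat' first | exact Df.var _ | exact Df.const (by assumption) | apply Dp.neg | apply Dp.and | apply Dp.or | apply Dp.sub htr | apply Dp.mem | apply Dp.eq | apply Dp.exM | apply Dp.allM | apply Dp.bex htr | apply Dp.ball htr | apply Dp.imp | apply Dp.iff | apply Df.pair htr hp)
  generalize hEe : ZFSet.sep _ _ = E at hE
  have mE : ∀ z, z ∈ E ↔ z ∈ ZFSet.prod T (ZFSet.prod T P) ∧ ∀ F ∈ M, (∀ σ ∈ T, ∀ x ∈ T, ∀ p ∈ P, Cl P r T F σ x p →
      ZFSet.pair σ (ZFSet.pair x p) ∈ F) → z ∈ F := by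
    intro z; rw [← hEe, ZFSet.mem_sep]
  have pre : ∀ σ ∈ T, ∀ x ∈ T, ∀ p ∈ P, Cl P r T E σ x p → ZFSet.pair σ (ZFSet.pair x p) ∈ E := by
    intro σ hσ x hx p hpP h
    rw [mE]
    refine ⟨mK σ hσ x hx p hpP, fun F hFM hF => hF σ hσ x hx p hpP (h.mono fun z hz => ?_)⟩
    exact ((mE z).1 hz).2 F hFM hF
  refine ⟨E, hE, fun σ hσ x hx p hpP => ⟨fun h => ?_, pre σ hσ x hx p hpP⟩⟩
  have hF := ZM_sep htr hM hK (R := fun z => ∃ σ ∈ T, ∃ x ∈ T, ∃ p ∈ P, z = ZFSet.pair σ (ZFSet.pair x p) ∧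
      Cl P r T E σ x p) (by
    simp only [Cl]
    repeat' first | exact Df.var _ | exact Df.const (by assumption) | apply Dp.neg | apply Dp.and | apply Dp.or | apply Dp.sub htr | apply Dp.mem | apply Dp.eq | apply Dp.exM | apply Dp.allM | apply Dp.bex htr | apply Dp.ball htr | apply Dp.imp | apply Dp.iff | apply Df.pair htr hp)
  have h2 := ((mE _).1 h).2 _ hF (fun σ hσ x hx p hpP h => ZFSet.mem_sep.2 ⟨mK σ hσ x hx p hpP,
    σ, hσ, x, hx, p, hpP, rfl, h.mono fun z hz => ?_⟩)
  · obtain ⟨σ', _, x', _, p', _, h3, h4⟩ := (ZFSet.mem_sep.1 h2).2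
    rw [ZFSet.pair_inj, ZFSet.pair_inj] at h3
    obtain ⟨rfl, rfl, rfl⟩ := h3
    exact h4
  · obtain ⟨σ', h1, x', h2, p', h3, rfl, h4⟩ := (ZFSet.mem_sep.1 hz).2
    exact pre _ h1 _ h2 _ h3 h4

theorem truth (htr : M.IsTransitive) (hM : ZModels M ZFC) {P r one G : ZFSet.{u}}
    (hF : ForcingNotion M P r one) (hG : IsGeneric M r P G) {T E : ZFSet.{u}} (hT : T ∈ M)
    (hTt : T.IsTransitive) (hE : E ∈ M)
    (hEc : ∀ σ ∈ T, ∀ x ∈ T, ∀ p ∈ P, ZFSet.pair σ (ZFSet.pair x p) ∈ E ↔ Cl P r T E σ x p) :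
    ∀ σ ∈ T, ∀ x ∈ T, zval G σ = x ↔ ∃ p ∈ G, ZFSet.pair σ (ZFSet.pair x p) ∈ E := by
  have hp := ZM_pair htr hM
  have hF' := hF
  have hG' := hG
  obtain ⟨hP, hr, h1, hrP, hrefl, htrans, hone⟩ := hF
  obtain ⟨⟨hGP, hGu, hGd⟩, hgen⟩ := hG
  have hdown : ∀ σ ∈ T, ∀ x ∈ T, ∀ p ∈ P, ∀ p' ∈ P, ZFSet.pair p' p ∈ r →
      ZFSet.pair σ (ZFSet.pair x p) ∈ E → ZFSet.pair σ (ZFSet.pair x p') ∈ E := by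
    intro σ hσ x hx p hpP p' hp' hle h
    rw [hEc σ hσ x hx _ hpP] at h
    rw [hEc σ hσ x hx _ hp']
    exact ⟨fun π hπ s hs hσ' q hq h1 h2 => h.1 π hπ s hs hσ' q hq (htrans _ hq _ hp' _ hpP h1 hle) h2,
      fun y hy q hq h1 => h.2 y hy q hq (htrans _ hq _ hp' _ hpP h1 hle)⟩
  have hπT : ∀ σ ∈ T, ∀ π s, ZFSet.pair π s ∈ σ → π ∈ T := by
    intro σ hσ π s h
    have h1 := hTt.subset_of_mem hσ h
    have h2 : ({π} : ZFSet.{u}) ∈ T := hTt.subset_of_mem h1 (by simp [ZFSet.pair])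
    exact hTt.subset_of_mem h2 (by simp)
  suffices ∀ o : Ordinal.{u}, ∀ σ ∈ T, σ.rank = o → ∀ x ∈ T, zval G σ = x ↔ ∃ p ∈ G, ZFSet.pair σ (ZFSet.pair x p) ∈ E from
    fun σ hσ => this _ σ hσ rfl
  intro o
  induction o using WellFoundedLT.induction with
  | ind o ih' =>
  intro σ hσ ho x hx
  have ih : ∀ π s, ZFSet.pair π s ∈ σ → ∀ y ∈ x, (zval G π = y ↔ ∃ p ∈ G, ZFSet.pair π (ZFSet.pair y p) ∈ E) :=
    fun π s h y hy => ih' _ (ho ▸ rank_lt_of_pair h) π (hπT σ hσ π s h) rfl y (hTt.subset_of_mem hx hy)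
  have hσM := htr.subset_of_mem hT hσ
  have hxM := htr.subset_of_mem hT hx
  constructor
  · intro hval
    have hD := ZM_sep htr hM hP (R := fun p => ZFSet.pair σ (ZFSet.pair x p) ∈ E ∨
      (∃ π ∈ T, ∃ s ∈ P, ZFSet.pair π s ∈ σ ∧ ZFSet.pair p s ∈ r ∧ ∀ q' ∈ P, ZFSet.pair q' p ∈ r →
        ∀ y ∈ x, ¬ ZFSet.pair π (ZFSet.pair y q') ∈ E) ∨
      (∃ y ∈ x, ∀ q' ∈ P, ZFSet.pair q' p ∈ r → ∀ π ∈ T, ∀ s ∈ P, ZFSet.pair π s ∈ σ → ZFSet.pair q' s ∈ r →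
        ¬ ZFSet.pair π (ZFSet.pair y q') ∈ E)) (by
      repeat' first | exact Df.var _ | exact Df.const (by assumption) | apply Dp.neg | apply Dp.and | apply Dp.or | apply Dp.sub htr | apply Dp.mem | apply Dp.eq | apply Dp.exM | apply Dp.allM | apply Dp.bex htr | apply Dp.ball htr | apply Dp.imp | apply Dp.iff | apply Df.pair htr hp)
    obtain ⟨p, hpG, hpD⟩ := hgen _ hD ⟨fun z hz => (ZFSet.mem_sep.1 hz).1, by
      intro p hpP
      by_cases hc : ZFSet.pair σ (ZFSet.pair x p) ∈ E
      · exact ⟨p, ZFSet.mem_sep.2 ⟨hpP, Or.inl hc⟩, hrefl p hpP⟩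
      · rw [hEc σ hσ x hx p hpP, Cl, not_and_or] at hc
        rcases hc with hc | hc
        · push Not at hc
          obtain ⟨π, hπ, s, hs, h2, q, hq, h3, h4, h5⟩ := hc
          exact ⟨q, ZFSet.mem_sep.2 ⟨hq, Or.inr (Or.inl ⟨π, hπ, s, hs, h2, h4, h5⟩)⟩, h3⟩
        · push Not at hc
          obtain ⟨y, hy, q, hq, h3, h5⟩ := hc
          exact ⟨q, ZFSet.mem_sep.2 ⟨hq, Or.inr (Or.inr ⟨y, hy, h5⟩)⟩, h3⟩⟩
    obtain ⟨hpP, hpD | hpD | hpD⟩ := ZFSet.mem_sep.1 hpD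
    · exact ⟨p, hpG, hpD⟩
    · exfalso
      obtain ⟨π, hπ, s, hs, h2, h3, h4⟩ := hpD
      have hsG := hGu p hpG s hs h3
      have hy : zval G π ∈ x := by
        rw [← hval, mem_zval]
        exact ⟨π, s, hsG, h2, rfl⟩
      obtain ⟨p2, hp2, h5⟩ := (ih π s h2 _ hy).1 rfl
      obtain ⟨q, hq, h6, h7⟩ := hGd p hpG p2 hp2
      exact h4 q (hGP hq) h6 _ hy (hdown π hπ _ (hTt.subset_of_mem hx hy) p2 (hGP hp2) q (hGP hq) h7 h5)
    · exfalso
      obtain ⟨y, hy, h2⟩ := hpD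
      have hy' := hy
      rw [← hval, mem_zval] at hy'
      obtain ⟨π, s, hsG, h3, h4⟩ := hy'
      obtain ⟨p2, hp2, h5⟩ := (ih π s h3 _ hy).1 h4.symm
      obtain ⟨q, hq, h6, h7⟩ := hGd p hpG p2 hp2
      obtain ⟨q', hq', h8, h9⟩ := hGd q hq s hsG
      have hπ := hπT σ hσ π s h3
      exact h2 q' (hGP hq') (htrans _ (hGP hq') _ (hGP hq) _ hpP h8 h6) π hπ s (hGP hsG) h3 h9
        (hdown π hπ _ (hTt.subset_of_mem hx hy) p2 (hGP hp2) q' (hGP hq')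
          (htrans _ (hGP hq') _ (hGP hq) _ (hGP hp2) h8 h7) h5)
  · rintro ⟨p, hpG, h⟩
    have hpP := hGP hpG
    rw [hEc σ hσ x hx p hpP] at h
    ext z
    constructor
    · intro hz
      rw [mem_zval] at hz
      obtain ⟨π, s, hsG, h2, rfl⟩ := hz
      have hπ := hπT σ hσ π s h2
      have hπM := htr.subset_of_mem hT hπ
      obtain ⟨p', hp', h3, h4⟩ := hGd p hpG s hsG
      have hD := ZM_sep htr hM hP (R := fun q => ∃ y ∈ x, ZFSet.pair π (ZFSet.pair y q) ∈ E) (by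
        repeat' first | exact Df.var _ | exact Df.const (by assumption) | apply Dp.neg | apply Dp.and | apply Dp.or | apply Dp.sub htr | apply Dp.mem | apply Dp.eq | apply Dp.exM | apply Dp.allM | apply Dp.bex htr | apply Dp.ball htr | apply Dp.imp | apply Dp.iff | apply Df.pair htr hp)
      obtain ⟨q, hq, hqD⟩ := dense_below htr hM hF' hG' hD (fun z hz => (ZFSet.mem_sep.1 hz).1) hp' (by
        intro q hq h5
        obtain ⟨q', hq', h6, h7⟩ := h.1 π hπ s (hGP hsG) h2 q hq (htrans _ hq _ (hGP hp') _ hpP h5 h3)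
          (htrans _ hq _ (hGP hp') _ (hGP hsG) h5 h4)
        exact ⟨q', ZFSet.mem_sep.2 ⟨hq', h7⟩, h6⟩)
      obtain ⟨_, y, hy, h5⟩ := ZFSet.mem_sep.1 hqD
      rw [(ih π s h2 y hy).2 ⟨q, hq, h5⟩]
      exact hy
    · intro hz
      have hzM := htr.subset_of_mem hxM hz
      have hD := ZM_sep htr hM hP (R := fun q => ∃ π ∈ T, ∃ s ∈ P, ZFSet.pair π s ∈ σ ∧
          ZFSet.pair q s ∈ r ∧ ZFSet.pair π (ZFSet.pair z q) ∈ E) (by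
        repeat' first | exact Df.var _ | exact Df.const (by assumption) | apply Dp.neg | apply Dp.and | apply Dp.or | apply Dp.sub htr | apply Dp.mem | apply Dp.eq | apply Dp.exM | apply Dp.allM | apply Dp.bex htr | apply Dp.ball htr | apply Dp.imp | apply Dp.iff | apply Df.pair htr hp)
      obtain ⟨q, hq, hqD⟩ := dense_below htr hM hF' hG' hD (fun z hz => (ZFSet.mem_sep.1 hz).1) hpG (by
        intro q hq h5
        obtain ⟨q', hq', h6, h7⟩ := h.2 z hz q hq h5
        exact ⟨q', ZFSet.mem_sep.2 ⟨hq', h7⟩, h6⟩)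
      obtain ⟨_, π, hπ, s, hs, h5, h6, h7⟩ := ZFSet.mem_sep.1 hqD
      rw [mem_zval]
      exact ⟨π, s, hGu q hq s hs h6, h5, ((ih π s h5 z hz).2 ⟨q, hq, h7⟩).symm⟩

theorem lemmaA (htr : M.IsTransitive) (hM : ZModels M ZFC) {P r one G : ZFSet.{u}}
    (hF : ForcingNotion M P r one) (hG : IsGeneric M r P G) {τ A : ZFSet.{u}} (hτ : τ ∈ M) (hA : A ∈ M) :
    ∃ R ∈ M, (∀ y ∈ A, y ∈ zval G τ ↔ ∃ p ∈ G, ZFSet.pair y p ∈ R) ∧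
      (∀ y ∈ A, ∀ p ∈ P, ∀ q ∈ P, ZFSet.pair q p ∈ r → ZFSet.pair y p ∈ R → ZFSet.pair y q ∈ R) := by
  have hp := ZM_pair htr hM
  have hF' := hF
  have hG' := hG
  obtain ⟨hP, hr, h1, hrP, hrefl, htrans, hone⟩ := hF
  obtain ⟨⟨hGP, hGu, hGd⟩, hgen⟩ := hG
  obtain ⟨T, hT, hTt, hxT, -⟩ := ZM_trcl htr hM _ (hp _ hτ _ hA)
  have hτT : τ ∈ T := hxT (by simp)
  have hAT : A ∈ T := hxT (by simp)
  obtain ⟨E, hE, hEc⟩ := exists_E htr hM hP hr hT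
  have tr := truth htr hM hF' hG' hT hTt hE hEc
  have hdown : ∀ σ ∈ T, ∀ x ∈ T, ∀ p ∈ P, ∀ p' ∈ P, ZFSet.pair p' p ∈ r →
      ZFSet.pair σ (ZFSet.pair x p) ∈ E → ZFSet.pair σ (ZFSet.pair x p') ∈ E := by
    intro σ hσ x hx p hpP p' hp' hle h
    rw [hEc σ hσ x hx _ hpP] at h
    rw [hEc σ hσ x hx _ hp']
    exact ⟨fun π hπ s hs hσ' q hq h1 h2 => h.1 π hπ s hs hσ' q hq (htrans _ hq _ hp' _ hpP h1 hle) h2,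
      fun y hy q hq h1 => h.2 y hy q hq (htrans _ hq _ hp' _ hpP h1 hle)⟩
  have hπT : ∀ σ ∈ T, ∀ π s, ZFSet.pair π s ∈ σ → π ∈ T := by
    intro σ hσ π s h
    have h1 := hTt.subset_of_mem hσ h
    have h2 : ({π} : ZFSet.{u}) ∈ T := hTt.subset_of_mem h1 (by simp [ZFSet.pair])
    exact hTt.subset_of_mem h2 (by simp)
  have hR := ZM_sep htr hM (ZM_prod htr hM hA hP) (R := fun z => ∃ y ∈ A, ∃ p ∈ P, z = ZFSet.pair y p ∧
      ∃ π ∈ T, ∃ s ∈ P, ZFSet.pair π s ∈ τ ∧ ZFSet.pair p s ∈ r ∧ ZFSet.pair π (ZFSet.pair y p) ∈ E) (by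
    repeat' first | exact Df.var _ | exact Df.const (by assumption) | apply Dp.neg | apply Dp.and | apply Dp.or | apply Dp.sub htr | apply Dp.mem | apply Dp.eq | apply Dp.exM | apply Dp.allM | apply Dp.bex htr | apply Dp.ball htr | apply Dp.imp | apply Dp.iff | apply Df.pair htr hp)
  generalize hRe : ZFSet.sep _ _ = R at hR
  have mR : ∀ y ∈ A, ∀ p ∈ P, ZFSet.pair y p ∈ R ↔
      ∃ π ∈ T, ∃ s ∈ P, ZFSet.pair π s ∈ τ ∧ ZFSet.pair p s ∈ r ∧ ZFSet.pair π (ZFSet.pair y p) ∈ E := by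
    intro y hy p hpP
    rw [← hRe, ZFSet.mem_sep]
    constructor
    · rintro ⟨_, y', _, p', _, h3, h4⟩
      rw [ZFSet.pair_inj] at h3
      obtain ⟨rfl, rfl⟩ := h3
      exact h4
    · intro h
      exact ⟨ZFSet.pair_mem_prod.2 ⟨hy, hpP⟩, y, hy, p, hpP, rfl, h⟩
  refine ⟨R, hR, fun y hy => ⟨fun h => ?_, ?_⟩, fun y hy p hpP q hq hle h => ?_⟩
  · rw [mem_zval] at h
    obtain ⟨π, s, hs, h2, h3⟩ := h
    have hπ := hπT τ hτT π s h2
    obtain ⟨p, hpG, h4⟩ := (tr π hπ y (hTt.subset_of_mem hAT hy)).1 h3.symm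
    obtain ⟨q, hq, h5, h6⟩ := hGd p hpG s hs
    refine ⟨q, hq, (mR y hy q (hGP hq)).2 ⟨π, hπ, s, hGP hs, h2, h6, ?_⟩⟩
    exact hdown π hπ y (hTt.subset_of_mem hAT hy) p (hGP hpG) q (hGP hq) h5 h4
  · rintro ⟨p, hpG, h⟩
    obtain ⟨π, hπ, s, hs, h2, h3, h4⟩ := (mR y hy p (hGP hpG)).1 h
    rw [mem_zval]
    exact ⟨π, s, hGu p hpG s hs h3, h2, ((tr π hπ y (hTt.subset_of_mem hAT hy)).2 ⟨p, hpG, h4⟩).symm⟩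
  · obtain ⟨π, hπ, s, hs, h2, h3, h4⟩ := (mR y hy p hpP).1 h
    exact (mR y hy q hq).2 ⟨π, hπ, s, hs, h2, htrans _ hq _ hpP _ hs hle h3,
      hdown π hπ y (hTt.subset_of_mem hAT hy) p hpP q hq hle h4⟩

theorem omega_ind {R : ZFSet.{u} → Prop} (h0 : R ∅)
    (hs : ∀ n ∈ ZFSet.omega.{u}, R n → R (insert n n)) : ∀ n ∈ ZFSet.omega.{u}, R n := by
  intro n hn
  have := omega_sub (J := ZFSet.sep R ZFSet.omega) (ZFSet.mem_sep.2 ⟨ZFSet.omega_zero, h0⟩)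
    (fun z hz => by
      rw [ZFSet.mem_sep] at hz ⊢
      exact ⟨ZFSet.omega_succ hz.1, hs z hz.1 hz.2⟩) n hn
  exact (ZFSet.mem_sep.1 this).2

theorem suc_inj {k n : ZFSet.{u}} (h : insert k k = insert n n) : k = n := by
  by_contra hne
  have h1 : k ∈ insert n n := h ▸ (by simp)
  have h2 : n ∈ insert k k := h ▸ (by simp)
  rw [ZFSet.mem_insert_iff] at h1 h2
  exact ZFSet.mem_asymm (h1.resolve_left hne) (h2.resolve_left (fun e => hne e.symm))

theorem suc_iff {n m : ZFSet.{u}} : (n ∈ m ∧ n ⊆ m ∧ ∀ w ∈ m, w ∈ n ∨ w = n) ↔ m = insert n n := by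
  constructor
  · rintro ⟨h1, h2, h3⟩
    ext w
    rw [ZFSet.mem_insert_iff]
    refine ⟨fun h => (h3 w h).symm, ?_⟩
    rintro (rfl | h)
    · exact h1
    · exact h2 h
  · rintro rfl
    refine ⟨by simp, ?_, ?_⟩
    · rw [ZFSet.subset_def]
      intro w hw
      exact ZFSet.mem_insert_of_mem _ hw
    · intro w hw
      exact (ZFSet.mem_insert_iff.1 hw).symm

theorem ZM_dc (htr : M.IsTransitive) (hM : ZModels M ZFC) {P Q p : ZFSet.{u}} (hP : P ∈ M) (hQ : Q ∈ M)
    (hpP : p ∈ P)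
    (h : ∀ n ∈ ZFSet.omega, ∀ q ∈ P, ∃ q' ∈ P, ZFSet.pair n (ZFSet.pair q q') ∈ Q) :
    ∃ s ∈ M, ZFSet.IsFunc ZFSet.omega P s ∧ ZFSet.pair ∅ p ∈ s ∧
      ∀ n ∈ ZFSet.omega, ∀ q q', ZFSet.pair n q ∈ s → ZFSet.pair (insert n n) q' ∈ s →
        ZFSet.pair n (ZFSet.pair q q') ∈ Q := by
  have hp := ZM_pair htr hM
  have hω := ZM_omega htr hM
  have h0M : (∅ : ZFSet.{u}) ∈ M := htr.subset_of_mem hω ZFSet.omega_zero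
  have hpM := htr.subset_of_mem hP hpP
  obtain ⟨α, hα, f, hf, hord, hsurj, hfun⟩ := ZM_ac htr hM hP
  let N : ZFSet.{u} → ZFSet.{u} → ZFSet.{u} → Prop := fun n q q' => ∃ ξ ∈ α, ZFSet.pair ξ q' ∈ f ∧
    ZFSet.pair n (ZFSet.pair q q') ∈ Q ∧ ∀ η ∈ ξ, ∀ q'' ∈ P, ZFSet.pair η q'' ∈ f →
      ¬ ZFSet.pair n (ZFSet.pair q q'') ∈ Q
  have hNex : ∀ n ∈ ZFSet.omega, ∀ q ∈ P, ∃ q' ∈ P, N n q q' := by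
    intro n hn q hq
    obtain ⟨q1, hq1, h1⟩ := h n hn q hq
    obtain ⟨ξ1, hξ1, h2⟩ := hsurj q1 hq1
    obtain ⟨ξ, ⟨hξ, q', hq', h3, h4⟩, hmin⟩ := ZFSet.mem_wf.has_min
      {ξ | ξ ∈ α ∧ ∃ q' ∈ P, ZFSet.pair ξ q' ∈ f ∧ ZFSet.pair n (ZFSet.pair q q') ∈ Q}
      ⟨ξ1, hξ1, q1, hq1, h2, h1⟩
    refine ⟨q', hq', ξ, hξ, h3, h4, fun η hη q'' hq'' h5 h6 => ?_⟩
    exact hmin η ⟨hord.isTransitive.subset_of_mem hξ hη, q'', hq'', h5, h6⟩ hη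
  have hNun : ∀ n q, ∀ a ∈ P, ∀ b ∈ P, N n q a → N n q b → a = b := by
    rintro n q a ha b hb ⟨ξ, hξ, h1, h2, h3⟩ ⟨ξ', hξ', h1', h2', h3'⟩
    rcases (hord.mem hξ).mem_trichotomous (hord.mem hξ') with h | rfl | h
    · exact absurd h2 (h3' ξ h a ha h1)
    · exact hfun _ _ _ h1 h1'
    · exact absurd h2' (h3 ξ' h b hb h1')
  have hNQ : ∀ n q q', N n q q' → ZFSet.pair n (ZFSet.pair q q') ∈ Q := by
    rintro n q q' ⟨ξ, hξ, h1, h2, h3⟩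
    exact h2
  let C : ZFSet.{u} → Prop := fun F => ZFSet.pair ∅ p ∈ F ∧ ∀ n ∈ ZFSet.omega.{u}, ∀ m ∈ ZFSet.omega.{u},
    (n ∈ m ∧ n ⊆ m ∧ ∀ w ∈ m, w ∈ n ∨ w = n) → ∀ q ∈ P, ∀ q' ∈ P, ZFSet.pair n q ∈ F → N n q q' →
      ZFSet.pair m q' ∈ F
  have hS := ZM_sep htr hM (ZM_prod htr hM hω hP) (R := fun z => ∀ F ∈ M, C F → z ∈ F) (by
    simp only [C, N]
    repeat' first | exact Df.var _ | exact Df.const (by assumption) | apply Dp.neg | apply Dp.and | apply Dp.or | apply Dp.sub htr | apply Dp.mem | apply Dp.eq | apply Dp.exM | apply Dp.allM | apply Dp.bex htr | apply Dp.ball htr | apply Dp.imp | apply Dp.iff | apply Df.pair htr hp)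
  generalize hSe : ZFSet.sep _ _ = S at hS
  have mS : ∀ z, z ∈ S ↔ z ∈ ZFSet.prod ZFSet.omega P ∧ ∀ F ∈ M, C F → z ∈ F := by
    intro z; rw [← hSe, ZFSet.mem_sep]
  have S0 : ZFSet.pair ∅ p ∈ S := (mS _).2 ⟨ZFSet.pair_mem_prod.2 ⟨ZFSet.omega_zero, hpP⟩, fun F _ hF => hF.1⟩
  have Ss : ∀ n ∈ ZFSet.omega.{u}, ∀ q ∈ P, ∀ q' ∈ P, ZFSet.pair n q ∈ S → N n q q' →
      ZFSet.pair (insert n n) q' ∈ S := by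
    intro n hn q hq q' hq' h1 h2
    refine (mS _).2 ⟨ZFSet.pair_mem_prod.2 ⟨ZFSet.omega_succ hn, hq'⟩, fun F hFM hF => ?_⟩
    exact hF.2 n hn _ (ZFSet.omega_succ hn) (suc_iff.2 rfl) q hq q' hq' (((mS _).1 h1).2 F hFM hF) h2
  have SP : ∀ n q, ZFSet.pair n q ∈ S → n ∈ ZFSet.omega ∧ q ∈ P := fun n q hh =>
    ZFSet.pair_mem_prod.1 ((mS _).1 hh).1
  -- removing a point
  have rem : ∀ z ∈ S, ¬ C (ZFSet.sep (fun w => ¬ w = z) S) := by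
    intro z hz hC
    have hzM := htr.subset_of_mem hS hz
    have hF := ZM_sep htr hM hS (R := fun w => ¬ w = z) (by
      repeat' first | exact Df.var _ | exact Df.const (by assumption) | apply Dp.neg | apply Dp.and | apply Dp.or | apply Dp.sub htr | apply Dp.mem | apply Dp.eq | apply Dp.exM | apply Dp.allM | apply Dp.bex htr | apply Dp.ball htr | apply Dp.imp | apply Dp.iff | apply Df.pair htr hp)
    exact (ZFSet.mem_sep.1 (((mS _).1 hz).2 _ hF hC)).2 rfl
  have uniq : ∀ n ∈ ZFSet.omega.{u}, ∃! q, ZFSet.pair n q ∈ S := by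
    refine omega_ind ⟨p, S0, fun q hq => ?_⟩ ?_
    · by_contra hne
      refine rem _ hq ⟨ZFSet.mem_sep.2 ⟨S0, fun e => hne (ZFSet.pair_inj.1 e).2.symm⟩, ?_⟩
      intro n hn m hm hnm a ha b hb h1 h2
      rw [ZFSet.mem_sep] at h1 ⊢
      rw [suc_iff] at hnm
      subst hnm
      refine ⟨Ss n hn a ha b hb h1.1 h2, fun e => ?_⟩
      have e1 := (ZFSet.pair_inj.1 e).1
      have : n ∈ (∅ : ZFSet.{u}) := e1 ▸ (by simp)
      exact ZFSet.notMem_empty _ this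
    · rintro n hn ⟨q, hq, huq⟩
      have hqP := (SP _ _ hq).2
      obtain ⟨q', hq', hN⟩ := hNex n hn q hqP
      refine ⟨q', Ss n hn q hqP q' hq' hq hN, fun q'' hq'' => ?_⟩
      by_contra hne
      refine rem _ hq'' ⟨ZFSet.mem_sep.2 ⟨S0, fun e => ?_⟩, ?_⟩
      · have e1 := (ZFSet.pair_inj.1 e).1
        have : n ∈ (∅ : ZFSet.{u}) := e1 ▸ (by simp)
        exact ZFSet.notMem_empty _ this
      intro k hk m hm hkm a ha b hb h1 h2
      rw [ZFSet.mem_sep] at h1 ⊢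
      rw [suc_iff] at hkm
      subst hkm
      refine ⟨Ss k hk a ha b hb h1.1 h2, fun e => ?_⟩
      obtain ⟨e1, rfl⟩ := ZFSet.pair_inj.1 e
      have e2 := suc_inj e1
      subst e2
      have e3 := huq a h1.1
      subst e3
      exact hne (hNun _ _ _ hb _ hq' h2 hN)
  refine ⟨S, hS, ⟨?_, uniq⟩, S0, ?_⟩
  · rw [ZFSet.subset_def]
    exact fun z hz => ((mS z).1 hz).1
  · intro n hn q q' h1 h2
    have hqP := (SP _ _ h1).2
    obtain ⟨b, hb, hN⟩ := hNex n hn q hqP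
    have := Ss n hn q hqP b hb h1 hN
    rw [(uniq _ (ZFSet.omega_succ hn)).unique h2 this]
    exact hNQ _ _ _ hN

theorem main_aux (htr : M.IsTransitive) (hM : ZModels M ZFC)
    (P r one : ZFSet.{u}) (hF : ForcingNotion M P r one)
    (hclosed : ∀ s ∈ M, ZFSet.IsFunc ZFSet.omega P s →
      (∀ a ∈ ZFSet.omega, ∀ b ∈ ZFSet.omega, ∀ u v : ZFSet, a ∈ b →
        ZFSet.pair a u ∈ s → ZFSet.pair b v ∈ s → ZFSet.pair v u ∈ r) →
      ∃ q ∈ P, ∀ a ∈ ZFSet.omega, ∀ u : ZFSet, ZFSet.pair a u ∈ s → ZFSet.pair q u ∈ r)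
    (G : ZFSet.{u}) (hG : IsGeneric M r P G) :
    ∀ f B : ZFSet.{u}, B ∈ M → f ∈ genExt M G → ZFSet.IsFunc ZFSet.omega B f → f ∈ M := by
  intro f B hB hf hfun
  have hp := ZM_pair htr hM
  have hω := ZM_omega htr hM
  have hF' := hF
  have hG' := hG
  obtain ⟨hP, hr, h1, hrP, hrefl, htrans, hone⟩ := hF
  obtain ⟨⟨hGP, hGu, hGd⟩, hgen⟩ := hG
  obtain ⟨τ, hτ, rfl⟩ := mem_genExt.1 hf
  have hA := ZM_prod htr hM hω hB
  obtain ⟨R, hR, hRt, hRd⟩ := lemmaA htr hM hF' hG' hτ hA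
  have hD := ZM_sep htr hM hP (R := fun p => (∀ n ∈ ZFSet.omega, ∃ b ∈ B, ZFSet.pair (ZFSet.pair n b) p ∈ R) ∨
      (∃ n ∈ ZFSet.omega, ∀ q ∈ P, ZFSet.pair q p ∈ r → ¬ ∃ b ∈ B, ZFSet.pair (ZFSet.pair n b) q ∈ R)) (by
    repeat' first | exact Df.var _ | exact Df.const (by assumption) | apply Dp.neg | apply Dp.and | apply Dp.or | apply Dp.sub htr | apply Dp.mem | apply Dp.eq | apply Dp.exM | apply Dp.allM | apply Dp.bex htr | apply Dp.ball htr | apply Dp.imp | apply Dp.iff | apply Df.pair htr hp)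
  obtain ⟨q, hqG, hqD⟩ := hgen _ hD ⟨fun z hz => (ZFSet.mem_sep.1 hz).1, by
    intro p hpP
    by_cases hc : ∃ d ∈ P, ZFSet.pair d p ∈ r ∧
      (∃ n ∈ ZFSet.omega, ∀ q ∈ P, ZFSet.pair q d ∈ r → ¬ ∃ b ∈ B, ZFSet.pair (ZFSet.pair n b) q ∈ R)
    · obtain ⟨d, hd, h2, h3⟩ := hc
      exact ⟨d, ZFSet.mem_sep.2 ⟨hd, Or.inr h3⟩, h2⟩
    push Not at hc
    have hpM := htr.subset_of_mem hP hpP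
    have hP' := ZM_sep htr hM hP (R := fun q => ZFSet.pair q p ∈ r) (by
      repeat' first | exact Df.var _ | exact Df.const (by assumption) | apply Dp.neg | apply Dp.and | apply Dp.or | apply Dp.sub htr | apply Dp.mem | apply Dp.eq | apply Dp.exM | apply Dp.allM | apply Dp.bex htr | apply Dp.ball htr | apply Dp.imp | apply Dp.iff | apply Df.pair htr hp)
    generalize hPe : ZFSet.sep (fun q => ZFSet.pair q p ∈ r) P = P' at hP'
    have mP' : ∀ q, q ∈ P' ↔ q ∈ P ∧ ZFSet.pair q p ∈ r := by
      intro q; rw [← hPe, ZFSet.mem_sep]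
    have hQ := ZM_sep htr hM (ZM_prod htr hM hω (ZM_prod htr hM hP' hP')) (R := fun z => ∃ n ∈ ZFSet.omega,
      ∃ q ∈ P', ∃ q' ∈ P', z = ZFSet.pair n (ZFSet.pair q q') ∧ ZFSet.pair q' q ∈ r ∧
        ∃ b ∈ B, ZFSet.pair (ZFSet.pair n b) q' ∈ R) (by
      repeat' first | exact Df.var _ | exact Df.const (by assumption) | apply Dp.neg | apply Dp.and | apply Dp.or | apply Dp.sub htr | apply Dp.mem | apply Dp.eq | apply Dp.exM | apply Dp.allM | apply Dp.bex htr | apply Dp.ball htr | apply Dp.imp | apply Dp.iff | apply Df.pair htr hp)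
    generalize hQe : ZFSet.sep _ (ZFSet.prod ZFSet.omega (ZFSet.prod P' P')) = Q at hQ
    have mQ : ∀ n q q', ZFSet.pair n (ZFSet.pair q q') ∈ Q ↔ n ∈ ZFSet.omega ∧ q ∈ P' ∧ q' ∈ P' ∧
        ZFSet.pair q' q ∈ r ∧ ∃ b ∈ B, ZFSet.pair (ZFSet.pair n b) q' ∈ R := by
      intro n q q'
      rw [← hQe, ZFSet.mem_sep]
      constructor
      · rintro ⟨_, n', h1, a, h2, a', h3, h4, h5⟩
        rw [ZFSet.pair_inj, ZFSet.pair_inj] at h4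
        obtain ⟨rfl, rfl, rfl⟩ := h4
        exact ⟨h1, h2, h3, h5⟩
      · rintro ⟨h1, h2, h3, h5⟩
        exact ⟨ZFSet.pair_mem_prod.2 ⟨h1, ZFSet.pair_mem_prod.2 ⟨h2, h3⟩⟩, n, h1, q, h2, q', h3, rfl, h5⟩
    obtain ⟨s, hs, ⟨hs1, hs2⟩, hs0, hss⟩ := ZM_dc htr hM hP' hQ ((mP' p).2 ⟨hpP, hrefl p hpP⟩) (by
      intro n hn q hq
      obtain ⟨hqP, hqp⟩ := (mP' q).1 hq
      obtain ⟨q', hq', h3, h4⟩ := hc q hqP hqp n hn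
      have hq'' := (mP' q').2 ⟨hq', htrans _ hq' _ hqP _ hpP h3 hqp⟩
      exact ⟨q', hq'', (mQ n q q').2 ⟨hn, hq, hq'', h3, h4⟩⟩)
    have sP : ∀ n q, ZFSet.pair n q ∈ s → q ∈ P := fun n q hh =>
      ((mP' q).1 (ZFSet.pair_mem_prod.1 (hs1 hh)).2).1
    have dec : ∀ b ∈ ZFSet.omega.{u}, ∀ a ∈ ZFSet.omega.{u}, ∀ u v : ZFSet.{u}, a ∈ b →
        ZFSet.pair a u ∈ s → ZFSet.pair b v ∈ s → ZFSet.pair v u ∈ r := by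
      refine omega_ind (fun a _ u v ha => absurd ha (ZFSet.notMem_empty _)) ?_
      intro b hb ih a ha u v hab hu hv
      obtain ⟨w, hw, -⟩ := hs2 b hb
      have h3 := ((mQ _ _ _).1 (hss b hb w v hw hv)).2.2.2.1
      rcases ZFSet.mem_insert_iff.1 hab with rfl | hab
      · rw [(hs2 a hb).unique hu hw]
        exact h3
      · exact htrans _ (sP _ _ hv) _ (sP _ _ hw) _ (sP _ _ hu) h3 (ih a ha u w hab hu hw)
    obtain ⟨q, hq, hqb⟩ := hclosed s hs ⟨by
      rw [ZFSet.subset_def]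
      intro z hz
      obtain ⟨a, ha, b, hb, rfl⟩ := ZFSet.mem_prod.1 (hs1 hz)
      exact ZFSet.pair_mem_prod.2 ⟨ha, ((mP' b).1 hb).1⟩, hs2⟩
      (fun a ha b hb u v => dec b hb a ha u v)
    refine ⟨q, ZFSet.mem_sep.2 ⟨hq, Or.inl fun n hn => ?_⟩, hqb ∅ ZFSet.omega_zero p hs0⟩
    obtain ⟨u, hu, -⟩ := hs2 n hn
    obtain ⟨v, hv, -⟩ := hs2 _ (ZFSet.omega_succ hn)
    obtain ⟨b, hb, h3⟩ := ((mQ _ _ _).1 (hss n hn u v hu hv)).2.2.2.2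
    exact ⟨b, hb, hRd _ (ZFSet.pair_mem_prod.2 ⟨hn, hb⟩) v (sP _ _ hv) q hq (hqb _ (ZFSet.omega_succ hn) v hv) h3⟩⟩
  obtain ⟨hqP, hq | hq⟩ := ZFSet.mem_sep.1 hqD
  · have hqM := htr.subset_of_mem hP hqP
    have hfin := ZM_sep htr hM hA (R := fun z => ZFSet.pair z q ∈ R) (by
      repeat' first | exact Df.var _ | exact Df.const (by assumption) | apply Dp.neg | apply Dp.and | apply Dp.or | apply Dp.sub htr | apply Dp.mem | apply Dp.eq | apply Dp.exM | apply Dp.allM | apply Dp.bex htr | apply Dp.ball htr | apply Dp.imp | apply Dp.iff | apply Df.pair htr hp)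
    convert hfin using 1
    ext z
    rw [ZFSet.mem_sep]
    constructor
    · intro hz
      refine ⟨hfun.1 hz, ?_⟩
      obtain ⟨n, hn, b, hb, rfl⟩ := ZFSet.mem_prod.1 (hfun.1 hz)
      obtain ⟨b', hb', h3⟩ := hq n hn
      have h4 := (hRt _ (ZFSet.pair_mem_prod.2 ⟨hn, hb'⟩)).2 ⟨q, hqG, h3⟩
      rw [(hfun.2 n hn).unique hz h4]
      exact h3
    · rintro ⟨hz, h3⟩
      exact (hRt z hz).2 ⟨q, hqG, h3⟩
  · exfalso
    obtain ⟨n, hn, h2⟩ := hq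
    obtain ⟨b, hb, -⟩ := hfun.2 n hn
    have hbB := hfun.1 hb
    obtain ⟨p2, hp2, h3⟩ := (hRt _ hbB).1 hb
    obtain ⟨q', hq', h4, h5⟩ := hGd q hqG p2 hp2
    exact h2 q' (hGP hq') h4 ⟨b, (ZFSet.pair_mem_prod.1 hbB).2, hRd _ hbB p2 (hGP hp2) q' (hGP hq') h5 h3⟩

end Definability

/-- countably closed forcing adds no new functions from `ω` into sets of the
ground model. -/
theorem countably_closed_no_new_omega_seq (M : ZFSet) (hcount : M.toSet.Countable)
    (htrans : M.IsTransitive) (hmodel : ZModels M ZFC)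
    (P r one : ZFSet) (hforcing : ForcingNotion M P r one)
    (hclosed : ∀ s ∈ M, ZFSet.IsFunc ZFSet.omega P s →
      (∀ a ∈ ZFSet.omega, ∀ b ∈ ZFSet.omega, ∀ u v : ZFSet, a ∈ b →
        ZFSet.pair a u ∈ s → ZFSet.pair b v ∈ s → ZFSet.pair v u ∈ r) →
      ∃ q ∈ P, ∀ a ∈ ZFSet.omega, ∀ u : ZFSet, ZFSet.pair a u ∈ s → ZFSet.pair q u ∈ r)
    (G : ZFSet) (hG : IsGeneric M r P G) :
    ∀ f B : ZFSet, B ∈ M → f ∈ genExt M G → ZFSet.IsFunc ZFSet.omega B f → f ∈ M := by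
  exact main_aux htrans hmodel P r one hforcing hclosed G hG

end CtmForcing
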